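/- For every γ > 0 there exists ε_γ > 0 such that for all 0 < ε < ε_γ the following holds: if μ is a Gibbs critical point of E_{ε,A} that is not a global minimizer of E_{ε,A}, then E_{ε,A}(μ) − m_ε ≥ Δ_0 − γ. -/

import Mathlib

open MeasureTheory Real Filter Topology

noncomputable section

/-- The unit sphere `S = 𝕊^{d-1}` in `ℝ^d`. -/
abbrev Sph (d : ℕ) : Type := Metric.sphere (0 : EuclideanSpace ℝ (Fin d)) 1

variable {d : ℕ}

/-- The bilinear form `⟨x, A y⟩` for the diagonal matrix `A = diag lam`. -/
def qA (lam : Fin d → ℝ) (x y : EuclideanSpace ℝ (Fin d)) : ℝ :=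
  ∑ i, lam i * x i * y i

/-- The interaction kernel `K_A(x,y) = exp ⟨x, A y⟩`. -/
def Kker (lam : Fin d → ℝ) (x y : Sph d) : ℝ :=
  Real.exp (qA lam (x : EuclideanSpace ℝ (Fin d)) (y : EuclideanSpace ℝ (Fin d)))

/-- The interaction energy `I_A(μ)`. -/
def IA (lam : Fin d → ℝ) (μ : Measure (Sph d)) : ℝ :=
  ∫ x, ∫ y, Kker lam x y ∂μ ∂μ

/-- The potential `W_μ(x) = ∫ K_A(x,y) dμ(y)`. -/
def WA (lam : Fin d → ℝ) (μ : Measure (Sph d)) (x : Sph d) : ℝ :=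
  ∫ y, Kker lam x y ∂μ

open scoped Classical in
/-- Relative entropy of `μ` with respect to `ω`, with value `+∞` when `μ` is not
absolutely continuous w.r.t. `ω` or the entropy integral diverges. -/
def Ent (ω μ : Measure (Sph d)) : EReal :=
  if μ ≪ ω ∧ Integrable (fun x => Real.log (μ.rnDeriv ω x).toReal) μ
  then ((∫ x, Real.log (μ.rnDeriv ω x).toReal ∂μ : ℝ) : EReal)
  else ⊤

/-- The free energy `E_{ε,A}(μ) = ε·Ent(μ) − (1/2)·I_A(μ)`. -/
def EA (lam : Fin d → ℝ) (ω : Measure (Sph d)) (ε : ℝ) (μ : Measure (Sph d)) : EReal :=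
  (ε : EReal) * Ent ω μ - ((IA lam μ / 2 : ℝ) : EReal)

/-- The antipodal map on the sphere. -/
def antip (x : Sph d) : Sph d :=
  ⟨-(x : EuclideanSpace ℝ (Fin d)), by
    have hx := x.2
    rw [mem_sphere_zero_iff_norm] at hx ⊢
    rwa [norm_neg]⟩

/-- The sphere self-map induced by a linear isometry equivalence of `ℝ^d`. -/
def sphMap (g : EuclideanSpace ℝ (Fin d) ≃ₗᵢ[ℝ] EuclideanSpace ℝ (Fin d)) (x : Sph d) : Sph d :=
  ⟨g (x : EuclideanSpace ℝ (Fin d)), by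
    have hx := x.2
    rw [mem_sphere_zero_iff_norm] at hx ⊢
    rwa [g.norm_map]⟩

/-- `ω` is the uniform probability measure on the sphere, characterised as a
rotation-invariant Borel probability measure. -/
def IsUniform (ω : Measure (Sph d)) : Prop :=
  IsProbabilityMeasure ω ∧
  ∀ g : EuclideanSpace ℝ (Fin d) ≃ₗᵢ[ℝ] EuclideanSpace ℝ (Fin d),
    Measure.map (sphMap g) ω = ω

/-- The (topological) support of a measure. -/
def msupport (μ : Measure (Sph d)) : Set (Sph d) :=
  {x | ∀ U : Set (Sph d), IsOpen U → x ∈ U → 0 < μ U}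

/-- The set of global maximizers of the potential `W_ν`. -/
def argmaxW (lam : Fin d → ℝ) (ν : Measure (Sph d)) : Set (Sph d) :=
  {x | ∀ y, WA lam ν y ≤ WA lam ν x}

/-- `μ` is a Gibbs critical point of `E_{ε,A}`. -/
def IsGibbs (lam : Fin d → ℝ) (ω : Measure (Sph d)) (ε : ℝ) (μ : Measure (Sph d)) : Prop :=
  IsProbabilityMeasure μ ∧
  μ = ω.withDensity (fun x => ENNReal.ofReal
    (Real.exp (WA lam μ x / ε) / ∫ z, Real.exp (WA lam μ z / ε) ∂ω))

/-- `μ` is a global minimizer of `E_{ε,A}` over Borel probability measures. -/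
def IsMinimizer (lam : Fin d → ℝ) (ω : Measure (Sph d)) (ε : ℝ) (μ : Measure (Sph d)) : Prop :=
  IsProbabilityMeasure μ ∧
  ∀ ν : Measure (Sph d), IsProbabilityMeasure ν → EA lam ω ε μ ≤ EA lam ω ε ν

/-- `m_ε`, the infimum of the free energy over probability measures. -/
def mEps (lam : Fin d → ℝ) (ω : Measure (Sph d)) (ε : ℝ) : EReal :=
  sInf {r : EReal | ∃ μ : Measure (Sph d), IsProbabilityMeasure μ ∧ EA lam ω ε μ = r}


structure Good (lam : Fin d → ℝ) (o : Fin d) (l2 : ℝ) : Prop where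
  pos : ∀ i, 0 < lam i
  le : ∀ i, lam i ≤ lam o
  le2 : ∀ i, i ≠ o → lam i ≤ l2
  lt : l2 < lam o

def pt (o : Fin d) : Sph d := ⟨EuclideanSpace.single o 1, by simp⟩

lemma pt_same (o : Fin d) : (pt o).1 o = 1 := by simp [pt]
lemma pt_ne {o i : Fin d} (h : i ≠ o) : (pt o).1 i = 0 := by simp [pt, h]

lemma sum_sq (x : Sph d) : ∑ i, (x.1 i) ^ 2 = 1 := by
  have h : ‖x.1‖ = 1 := by simp
  rw [← EuclideanSpace.real_norm_sq_eq, h]; norm_num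

lemma nrm (x : Sph d) : ‖x.1‖ = 1 := by simp

lemma co_sq_le (x : Sph d) (i : Fin d) : (x.1 i) ^ 2 ≤ 1 := by
  refine le_of_le_of_eq ?_ (sum_sq x)
  exact Finset.single_le_sum (f := fun i => (x.1 i)^2) (fun j _ => sq_nonneg _) (Finset.mem_univ i)

lemma co_abs_le (x : Sph d) (i : Fin d) : |x.1 i| ≤ 1 := by
  rw [← sq_le_one_iff_abs_le_one]; exact co_sq_le x i

lemma co_le (x : Sph d) (i : Fin d) : x.1 i ≤ 1 := (abs_le.1 (co_abs_le x i)).2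
lemma neg_le_co (x : Sph d) (i : Fin d) : -1 ≤ x.1 i := (abs_le.1 (co_abs_le x i)).1

@[fun_prop]
lemma cont_co (i : Fin d) : Continuous (fun x : Sph d => x.1 i) := by fun_prop

@[fun_prop]
lemma cont_K (lam : Fin d → ℝ) : Continuous (fun p : Sph d × Sph d => Kker lam p.1 p.2) := by
  unfold Kker qA; fun_prop

lemma cont_K1 (lam : Fin d → ℝ) (y : Sph d) : Continuous (fun x => Kker lam x y) := by
  unfold Kker qA; fun_prop
lemma cont_K2 (lam : Fin d → ℝ) (x : Sph d) : Continuous (fun y => Kker lam x y) := by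
  unfold Kker qA; fun_prop

lemma K_symm (lam : Fin d → ℝ) (x y : Sph d) : Kker lam x y = Kker lam y x := by
  unfold Kker qA; congr 1; apply Finset.sum_congr rfl; intros; ring

lemma K_pos (lam : Fin d → ℝ) (x y : Sph d) : 0 < Kker lam x y := Real.exp_pos _

lemma qA_bound {lam : Fin d → ℝ} {o : Fin d} (h0 : ∀ i, 0 < lam i) (h1 : ∀ i, lam i ≤ lam o)
    (u y : EuclideanSpace ℝ (Fin d)) : |qA lam u y| ≤ lam o * ‖u‖ * ‖y‖ := by
  have ho := (h0 o).le
  apply abs_le_of_sq_le_sq _ (by positivity)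
  unfold qA
  calc (∑ i, lam i * u i * y i)^2 ≤ (∑ i, (lam i * u i)^2) * ∑ i, (y i)^2 :=
        Finset.sum_mul_sq_le_sq_mul_sq _ _ _
    _ ≤ (∑ i, (lam o)^2 * (u i)^2) * ∑ i, (y i)^2 := by
        gcongr with i
        rw [mul_pow]
        gcongr
        · exact (h0 i).le
        · exact h1 i
    _ = _ := by
        rw [← Finset.mul_sum, mul_pow, mul_pow, EuclideanSpace.real_norm_sq_eq, EuclideanSpace.real_norm_sq_eq]

lemma qA_sub (lam : Fin d → ℝ) (u v y : EuclideanSpace ℝ (Fin d)) :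
    qA lam u y - qA lam v y = qA lam (u - v) y := by
  unfold qA; rw [← Finset.sum_sub_distrib]; apply Finset.sum_congr rfl; intros; simp; ring

lemma exp_lip {a b M : ℝ} (ha : a ≤ M) (hb : b ≤ M) : |exp a - exp b| ≤ exp M * |a - b| := by
  have key : ∀ a b : ℝ, a ≤ M → b ≤ a → |exp a - exp b| ≤ exp M * |a - b| := by
    intro a b ha hba
    rw [abs_of_nonneg (by simpa using hba), abs_of_nonneg (by linarith)]
    have h1 : exp b = exp a * exp (b - a) := by rw [← exp_add]; ring_nf
    have h2 := add_one_le_exp (b - a)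
    have h3 : exp a ≤ exp M := exp_le_exp.2 ha
    have h4 := exp_pos a
    calc exp a - exp b ≤ exp a * (a - b) := by rw [h1]; nlinarith
      _ ≤ _ := by gcongr
  rcases le_total b a with h | h
  · exact key a b ha h
  · rw [abs_sub_comm, abs_sub_comm a b]; exact key b a hb h

section
variable {lam : Fin d → ℝ} {o : Fin d} {l2 : ℝ}

lemma q_abs (h : Good lam o l2) (x y : Sph d) : |qA lam x.1 y.1| ≤ lam o := by
  have := qA_bound h.pos h.le x.1 y.1
  rwa [nrm, nrm, mul_one, mul_one] at this

lemma K_le (h : Good lam o l2) (x y : Sph d) : Kker lam x y ≤ exp (lam o) :=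
  exp_le_exp.2 (abs_le.1 (q_abs h x y)).2

lemma le_K (h : Good lam o l2) (x y : Sph d) : exp (-lam o) ≤ Kker lam x y :=
  exp_le_exp.2 (abs_le.1 (q_abs h x y)).1

/-- Lipschitz constant -/
def Lc (lam : Fin d → ℝ) (o : Fin d) : ℝ := exp (lam o) * lam o

lemma Lc_pos (h : Good lam o l2) : 0 < Lc lam o := mul_pos (exp_pos _) (h.pos o)

lemma K_lip (h : Good lam o l2) (x x' y : Sph d) :
    |Kker lam x y - Kker lam x' y| ≤ Lc lam o * dist x x' := by
  unfold Kker Lc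
  refine (exp_lip (abs_le.1 (q_abs h x y)).2 (abs_le.1 (q_abs h x' y)).2).trans ?_
  rw [mul_assoc, qA_sub]
  gcongr
  have := qA_bound h.pos h.le (x.1 - x'.1) y.1
  rwa [nrm, mul_one, ← dist_eq_norm] at this

lemma K_lip2 (h : Good lam o l2) (x y y' : Sph d) :
    |Kker lam x y - Kker lam x y'| ≤ Lc lam o * dist y y' := by
  rw [K_symm lam x, K_symm lam x]; exact K_lip h y y' x

end

/-- the defect 1 - x_o -/
def aa (o : Fin d) (x : Sph d) : ℝ := 1 - x.1 o

@[fun_prop]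
lemma cont_aa (o : Fin d) : Continuous (aa o) := by unfold aa; fun_prop

lemma aa_nonneg (o : Fin d) (x : Sph d) : 0 ≤ aa o x := by have := co_le x o; unfold aa; linarith
lemma aa_le (o : Fin d) (x : Sph d) : aa o x ≤ 2 := by have := neg_le_co x o; unfold aa; linarith
lemma aa_pt (o : Fin d) : aa o (pt o) = 0 := by simp [aa, pt_same]

lemma dist_sq_pt (o : Fin d) (x : Sph d) : dist x (pt o) ^ 2 = 2 * aa o x := by
  have : dist x (pt o) = ‖x.1 - (pt o).1‖ := by rw [← dist_eq_norm]; rfl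
  rw [this, @norm_sub_sq_real, nrm, nrm]
  have : inner ℝ x.1 (pt o).1 = x.1 o := by
    simp [pt, EuclideanSpace.inner_single_right]
  rw [this]; unfold aa; ring

lemma dist_pt (o : Fin d) (x : Sph d) : dist x (pt o) = √2 * √(aa o x) := by
  rw [← Real.sqrt_mul (by norm_num), ← dist_sq_pt, Real.sqrt_sq dist_nonneg]

lemma dist_pt_le (o : Fin d) (x : Sph d) : dist x (pt o) ≤ 2 * √(aa o x) := by
  rw [dist_pt]; gcongr; rw [Real.sqrt_le_left (by norm_num)]; norm_num

lemma sum_ne_sq (o : Fin d) (x : Sph d) : ∑ i ∈ Finset.univ.erase o, (x.1 i)^2 = 1 - (x.1 o)^2 := by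
  have h := sum_sq x
  rw [← Finset.add_sum_erase _ _ (Finset.mem_univ o)] at h; linarith

lemma co_sq_le_aa {o i : Fin d} (hi : i ≠ o) (x : Sph d) : (x.1 i)^2 ≤ 2 * aa o x := by
  have h1 : (x.1 i)^2 ≤ ∑ i ∈ Finset.univ.erase o, (x.1 i)^2 :=
    Finset.single_le_sum (f := fun i => (x.1 i)^2) (fun j _ => sq_nonneg _) (by simp [hi])
  rw [sum_ne_sq] at h1
  have := co_le x o
  have := neg_le_co x o
  unfold aa; nlinarith

lemma co_abs_le_aa {o i : Fin d} (hi : i ≠ o) (x : Sph d) : |x.1 i| ≤ 2 * √(aa o x) := by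
  apply abs_le_of_sq_le_sq _ (by positivity)
  rw [mul_pow, Real.sq_sqrt (aa_nonneg o x)]
  have := co_sq_le_aa hi x; have := aa_nonneg o x; linarith

lemma intg {f : Sph d → ℝ} (hf : Continuous f) (μ : Measure (Sph d)) [IsFiniteMeasure μ] :
    Integrable f μ := by
  obtain ⟨C, hC⟩ := isCompact_univ.exists_bound_of_continuousOn hf.continuousOn
  exact Integrable.of_bound hf.aestronglyMeasurable C (ae_of_all _ fun x => hC x (Set.mem_univ x))

lemma cont_int {X : Type*} [TopologicalSpace X] [FirstCountableTopology X] [LocallyCompactSpace X]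
    {f : X → Sph d → ℝ} (hf : Continuous f.uncurry) (μ : Measure (Sph d)) [IsFiniteMeasure μ] :
    Continuous (fun x => ∫ y, f x y ∂μ) := by
  have := continuous_parametric_integral_of_continuous (μ := μ) hf isCompact_univ
  simpa using this

section
variable {lam : Fin d → ℝ} {o : Fin d} {l2 : ℝ}

@[fun_prop]
lemma cont_W (lam : Fin d → ℝ) (μ : Measure (Sph d)) [IsFiniteMeasure μ] : Continuous (WA lam μ) := by
  unfold WA; exact cont_int (f := fun x y => Kker lam x y) (cont_K lam) μ

lemma W_le (h : Good lam o l2) (μ : Measure (Sph d)) [IsProbabilityMeasure μ] (x : Sph d) :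
    WA lam μ x ≤ exp (lam o) := by
  have := integral_mono (intg (cont_K2 lam x) μ) (integrable_const (exp (lam o))) (fun y => K_le h x y)
  simpa [WA] using this

lemma le_W (h : Good lam o l2) (μ : Measure (Sph d)) [IsProbabilityMeasure μ] (x : Sph d) :
    exp (-lam o) ≤ WA lam μ x := by
  have := integral_mono (integrable_const (exp (-lam o))) (intg (cont_K2 lam x) μ) (fun y => le_K h x y)
  simpa [WA] using this

lemma W_lip (h : Good lam o l2) (μ : Measure (Sph d)) [IsProbabilityMeasure μ] (x x' : Sph d) :
    |WA lam μ x - WA lam μ x'| ≤ Lc lam o * dist x x' := by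
  unfold WA
  rw [← integral_sub (intg (cont_K2 lam x) μ) (intg (cont_K2 lam x') μ)]
  have := norm_integral_le_of_norm_le_const (μ := μ) (f := fun y => Kker lam x y - Kker lam x' y)
    (ae_of_all _ fun y => K_lip h x x' y)
  simpa using this

lemma IA_le (h : Good lam o l2) (μ : Measure (Sph d)) [IsProbabilityMeasure μ] :
    IA lam μ ≤ exp (lam o) := by
  have := integral_mono (intg (cont_W lam μ) μ) (integrable_const (exp (lam o))) (fun y => W_le h μ y)
  simpa [IA, WA] using this

lemma IA_eq (lam : Fin d → ℝ) (μ : Measure (Sph d)) : IA lam μ = ∫ x, WA lam μ x ∂μ := rfl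

lemma dbl_swap (μ ν : Measure (Sph d)) [IsFiniteMeasure μ] [IsFiniteMeasure ν]
    {F : Sph d → Sph d → ℝ} (hF : Continuous F.uncurry) :
    ∫ x, ∫ y, F x y ∂ν ∂μ = ∫ y, ∫ x, F x y ∂μ ∂ν := by
  apply integral_integral_swap
  obtain ⟨C, hC⟩ := isCompact_univ.exists_bound_of_continuousOn hF.continuousOn
  exact Integrable.of_bound hF.aestronglyMeasurable C (ae_of_all _ fun x => hC x (Set.mem_univ x))
end


section posdef
variable {lam : Fin d → ℝ} {o : Fin d} {l2 : ℝ}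

lemma intg2 {f : Sph d × Sph d → ℝ} (hf : Continuous f) (μ : Measure (Sph d × Sph d)) [IsFiniteMeasure μ] :
    Integrable f μ := by
  obtain ⟨C, hC⟩ := isCompact_univ.exists_bound_of_continuousOn hf.continuousOn
  exact Integrable.of_bound hf.aestronglyMeasurable C (ae_of_all _ fun x => hC x (Set.mem_univ x))

lemma mono_nonneg (c : ℝ) (hc : 0 ≤ c) {m : Sph d → ℝ}
    (μ ν : Measure (Sph d)) [IsProbabilityMeasure μ] [IsProbabilityMeasure ν] :
    0 ≤ ∫ p, c * (m p.1 * m p.2) ∂(μ.prod μ) + ∫ p, c * (m p.1 * m p.2) ∂(ν.prod ν)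
      - 2 * ∫ p, c * (m p.1 * m p.2) ∂(μ.prod ν) := by
  simp only [integral_const_mul, integral_prod_mul]
  have := mul_nonneg hc (sq_nonneg ((∫ x, m x ∂μ) - ∫ x, m x ∂ν))
  nlinarith

def qn (lam : Fin d → ℝ) (n : ℕ) (p : Sph d × Sph d) : ℝ :=
  ∑ k ∈ Finset.range n, (qA lam p.1.1 p.2.1) ^ k / (k.factorial : ℝ)

lemma cont_qn (lam : Fin d → ℝ) (n : ℕ) : Continuous (qn lam n) := by
  unfold qn qA; fun_prop

lemma qn_nonneg (h : Good lam o l2) (n : ℕ)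
    (μ ν : Measure (Sph d)) [IsProbabilityMeasure μ] [IsProbabilityMeasure ν] :
    0 ≤ ∫ p, qn lam n p ∂(μ.prod μ) + ∫ p, qn lam n p ∂(ν.prod ν)
      - 2 * ∫ p, qn lam n p ∂(μ.prod ν) := by
  have hq : ∀ p : Sph d × Sph d, qn lam n p = ∑ k ∈ Finset.range n, ∑ s : Fin k → Fin d,
      ((∏ j, lam (s j)) / (k.factorial : ℝ)) * ((∏ j, p.1.1 (s j)) * (∏ j, p.2.1 (s j))) := by
    intro p
    unfold qn qA
    apply Finset.sum_congr rfl
    intro k _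
    rw [Fintype.sum_pow, Finset.sum_div]
    apply Finset.sum_congr rfl
    intro s _
    rw [Finset.prod_mul_distrib, Finset.prod_mul_distrib]; ring
  have hi : ∀ m : Measure (Sph d × Sph d), IsFiniteMeasure m → ∫ p, qn lam n p ∂m =
      ∑ k ∈ Finset.range n, ∑ s : Fin k → Fin d, ∫ p,
      ((∏ j, lam (s j)) / (k.factorial : ℝ)) * ((∏ j, p.1.1 (s j)) * (∏ j, p.2.1 (s j))) ∂m := by
    intro m _
    simp_rw [hq]
    rw [integral_finsetSum]
    · apply Finset.sum_congr rfl
      intro k _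
      rw [integral_finsetSum]
      intro s _
      exact intg2 (by fun_prop) m
    · intro k _
      exact intg2 (by fun_prop) m
  rw [hi _ inferInstance, hi _ inferInstance, hi _ inferInstance, Finset.mul_sum,
    ← Finset.sum_add_distrib, ← Finset.sum_sub_distrib]
  apply Finset.sum_nonneg
  intro k _
  rw [Finset.mul_sum, ← Finset.sum_add_distrib, ← Finset.sum_sub_distrib]
  apply Finset.sum_nonneg
  intro s _
  exact mono_nonneg _ (div_nonneg (Finset.prod_nonneg fun j _ => (h.pos _).le) (by positivity))
    (m := fun x : Sph d => ∏ j, x.1 (s j)) μ ν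

lemma qn_tendsto (h : Good lam o l2) (m : Measure (Sph d × Sph d)) [IsProbabilityMeasure m] :
    Tendsto (fun n => ∫ p, qn lam n p ∂m) atTop (𝓝 (∫ p, Kker lam p.1 p.2 ∂m)) := by
  apply tendsto_integral_of_dominated_convergence (fun _ => exp (lam o))
  · exact fun n => (cont_qn lam n).aestronglyMeasurable
  · exact integrable_const _
  · intro n
    refine ae_of_all _ fun p => ?_
    have h1 : ‖qn lam n p‖ ≤ ∑ k ∈ Finset.range n, |qA lam p.1.1 p.2.1| ^ k / (k.factorial : ℝ) := by
      unfold qn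
      refine (norm_sum_le _ _).trans (le_of_eq ?_)
      apply Finset.sum_congr rfl
      intro k _
      rw [norm_div, norm_pow, Real.norm_eq_abs, Real.norm_eq_abs, Nat.abs_cast]
    exact h1.trans ((Real.sum_le_exp_of_nonneg (abs_nonneg _) n).trans (exp_le_exp.2 (q_abs h _ _)))
  · refine ae_of_all _ fun p => ?_
    have := (NormedSpace.expSeries_div_hasSum_exp (𝔸 := ℝ) (qA lam p.1.1 p.2.1)).tendsto_sum_nat
    rw [← Real.exp_eq_exp_ℝ] at this
    exact this

lemma posdef (h : Good lam o l2)
    (μ ν : Measure (Sph d)) [IsProbabilityMeasure μ] [IsProbabilityMeasure ν] :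
    2 * ∫ x, WA lam ν x ∂μ ≤ IA lam μ + IA lam ν := by
  have key := ge_of_tendsto' (((qn_tendsto h (μ.prod μ)).add (qn_tendsto h (ν.prod ν))).sub
    ((qn_tendsto h (μ.prod ν)).const_mul 2)) (fun n => qn_nonneg h n μ ν)
  have hp : ∀ (μ ν : Measure (Sph d)), IsProbabilityMeasure μ → IsProbabilityMeasure ν →
      ∫ p, Kker lam p.1 p.2 ∂(μ.prod ν) = ∫ x, WA lam ν x ∂μ := by
    intro μ ν _ _
    rw [integral_prod _ (intg2 (cont_K lam) _)]; rfl
  rw [hp _ _ inferInstance inferInstance, hp _ _ inferInstance inferInstance,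
    hp _ _ inferInstance inferInstance] at key
  rw [IA_eq, IA_eq]; linarith
end posdef

section omega
variable {ω : Measure (Sph d)}

lemma cont_sphMap (g : EuclideanSpace ℝ (Fin d) ≃ₗᵢ[ℝ] EuclideanSpace ℝ (Fin d)) :
    Continuous (sphMap g) := by
  unfold sphMap
  exact Continuous.subtype_mk (g.continuous.comp continuous_subtype_val) _

lemma omega_ball_eq (hω : IsUniform ω) (x y : Sph d) (ρ : ℝ) :
    ω (Metric.ball x ρ) = ω (Metric.ball y ρ) := by
  have hn : ‖x.1‖ = ‖y.1‖ := by rw [nrm, nrm]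
  set g := Submodule.reflection (ℝ ∙ (x.1 - y.1))ᗮ with hg
  have hgx : g x.1 = y.1 := Submodule.reflection_sub hn
  have h2 := hω.2 g
  conv_rhs => rw [← h2]
  rw [Measure.map_apply (cont_sphMap g).measurable measurableSet_ball]
  congr 1
  ext z
  simp only [Set.mem_preimage, Metric.mem_ball]
  have : dist (sphMap g z) y = dist z x := by
    change dist (g z.1) y.1 = dist z.1 x.1
    rw [← hgx, g.dist_map]
  rw [this]

lemma omega_ball (hω : IsUniform ω) {ρ : ℝ} (hρ : 0 < ρ) :
    ∃ c : ℝ, 0 < c ∧ ∀ x, ω.real (Metric.ball x ρ) = c := by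
  have := hω.1
  obtain ⟨x0⟩ : Nonempty (Sph d) := by
    by_contra hne
    rw [not_nonempty_iff] at hne
    have : ω = 0 := Measure.eq_zero_of_isEmpty ω
    have h1 := hω.1.measure_univ
    simp [this] at h1
  refine ⟨ω.real (Metric.ball x0 ρ), ?_, fun x => by
    rw [measureReal_def, measureReal_def, omega_ball_eq hω x x0]⟩
  rw [measureReal_def, ENNReal.toReal_pos_iff]
  refine ⟨?_, measure_lt_top _ _⟩
  rw [pos_iff_ne_zero]
  intro h0
  obtain ⟨t, ht⟩ := isCompact_univ.elim_finite_subcover (fun x : Sph d => Metric.ball x ρ)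
    (fun x => Metric.isOpen_ball) (fun x _ => Set.mem_iUnion.2 ⟨x, Metric.mem_ball_self hρ⟩)
  have h1 : ω Set.univ ≤ 0 := by
    calc ω Set.univ ≤ ω (⋃ i ∈ t, Metric.ball i ρ) := measure_mono ht
      _ ≤ ∑ i ∈ t, ω (Metric.ball i ρ) := measure_biUnion_finset_le _ _
      _ = 0 := Finset.sum_eq_zero fun i _ => by rw [omega_ball_eq hω i x0, h0]
  rw [hω.1.measure_univ] at h1
  simp at h1

lemma expcont {f : Sph d → ℝ} (hf : Continuous f) : Continuous (fun x => exp (f x)) := by fun_prop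

lemma Z_lower [IsProbabilityMeasure ω] {f : Sph d → ℝ} (hf : Continuous f) (s : Set (Sph d))
    (hs : MeasurableSet s) (m : ℝ) (hm : ∀ x ∈ s, m ≤ f x) :
    exp m * ω.real s ≤ ∫ x, exp (f x) ∂ω := by
  have h1 : ∫ x in s, exp m ∂ω ≤ ∫ x in s, exp (f x) ∂ω :=
    setIntegral_mono_on (integrable_const _) (intg (expcont hf) _) hs
      (fun x hx => exp_le_exp.2 (hm x hx))
  have h2 : ∫ x in s, exp (f x) ∂ω ≤ ∫ x, exp (f x) ∂ω :=
    setIntegral_le_integral (intg (expcont hf) _) (ae_of_all _ fun x => (exp_pos _).le)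
  rw [setIntegral_const, smul_eq_mul] at h1
  linarith
end omega

section energy
variable {lam : Fin d → ℝ} {o : Fin d} {l2 : ℝ} {ω : Measure (Sph d)} {ε : ℝ}

def Tm (lam : Fin d → ℝ) (ω : Measure (Sph d)) (ε : ℝ) (ν : Measure (Sph d)) : Measure (Sph d) :=
  ω.tilted (fun x => WA lam ν x / ε)

def Zf (lam : Fin d → ℝ) (ω : Measure (Sph d)) (ε : ℝ) (ν : Measure (Sph d)) : ℝ :=
  ∫ x, exp (WA lam ν x / ε) ∂ω

def Jf (lam : Fin d → ℝ) (ω : Measure (Sph d)) (ε : ℝ) (ν : Measure (Sph d)) : ℝ :=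
  IA lam ν / 2 - ε * log (Zf lam ω ε ν)

lemma cont_We (lam : Fin d → ℝ) (ε : ℝ) (μ : Measure (Sph d)) [IsFiniteMeasure μ] :
    Continuous (fun x => WA lam μ x / ε) := (cont_W lam μ).div_const ε

lemma gibbs_iff {μ : Measure (Sph d)} :
    IsGibbs lam ω ε μ ↔ IsProbabilityMeasure μ ∧ μ = Tm lam ω ε μ := Iff.rfl

lemma prob_tilted [IsProbabilityMeasure ω] {f : Sph d → ℝ} (hf : Continuous f) :
    IsProbabilityMeasure (ω.tilted f) := isProbabilityMeasure_tilted (intg (expcont hf) ω)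

lemma prob_Tm [IsProbabilityMeasure ω] (ν : Measure (Sph d)) [IsFiniteMeasure ν] :
    IsProbabilityMeasure (Tm lam ω ε ν) := prob_tilted (cont_We lam ε ν)

lemma Zf_pos [IsProbabilityMeasure ω] (ν : Measure (Sph d)) [IsFiniteMeasure ν] :
    0 < Zf lam ω ε ν := integral_exp_pos (intg (expcont (cont_We lam ε ν)) ω)

lemma EA_top (hε : 0 < ε) {μ : Measure (Sph d)}
    (h : ¬ (μ ≪ ω ∧ Integrable (fun x => Real.log (μ.rnDeriv ω x).toReal) μ)) :
    EA lam ω ε μ = ⊤ := by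
  unfold EA Ent
  rw [if_neg h, EReal.coe_mul_top_of_pos hε]
  rfl

lemma EA_fin {μ : Measure (Sph d)}
    (h : μ ≪ ω ∧ Integrable (fun x => Real.log (μ.rnDeriv ω x).toReal) μ) :
    EA lam ω ε μ = ((ε * (∫ x, llr μ ω x ∂μ) - IA lam μ / 2 : ℝ) : EReal) := by
  unfold EA Ent
  rw [if_pos h]
  push_cast
  rfl

lemma llr_T [IsProbabilityMeasure ω] (hε : 0 < ε) (μ ν : Measure (Sph d)) [IsProbabilityMeasure μ]
    [IsProbabilityMeasure ν]
    (h : μ ≪ ω ∧ Integrable (fun x => Real.log (μ.rnDeriv ω x).toReal) μ) :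
    ε * (∫ x, llr μ ω x ∂μ) = ε * (InformationTheory.klDiv μ (Tm lam ω ε ν)).toReal
      + ∫ x, WA lam ν x ∂μ - ε * log (Zf lam ω ε ν) := by
  have hp : IsProbabilityMeasure (Tm lam ω ε ν) := prob_Tm ν
  have hac : ω ≪ Tm lam ω ε ν := absolutelyContinuous_tilted (intg (expcont (cont_We lam ε ν)) ω)
  rw [InformationTheory.toReal_klDiv_of_measure_eq (h.1.trans hac) (by simp)]
  unfold Tm Zf
  rw [integral_llr_tilted_right h.1 (intg (cont_We lam ε ν) μ) (intg (expcont (cont_We lam ε ν)) ω) h.2,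
    integral_div]
  field_simp
  ring

lemma EA_ge [IsProbabilityMeasure ω] (hε : 0 < ε) (μ ν : Measure (Sph d)) [IsProbabilityMeasure μ]
    [IsProbabilityMeasure ν] :
    ((∫ x, WA lam ν x ∂μ - ε * log (Zf lam ω ε ν) - IA lam μ / 2 : ℝ) : EReal) ≤ EA lam ω ε μ := by
  by_cases h : μ ≪ ω ∧ Integrable (fun x => Real.log (μ.rnDeriv ω x).toReal) μ
  · rw [EA_fin h, EReal.coe_le_coe_iff, llr_T hε μ ν h]
    have : 0 ≤ ε * (InformationTheory.klDiv μ (Tm lam ω ε ν)).toReal := by positivity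
    linarith
  · rw [EA_top hε h]; exact le_top

lemma fin_T [IsProbabilityMeasure ω] (ν : Measure (Sph d)) [IsProbabilityMeasure ν] :
    (Tm lam ω ε ν) ≪ ω ∧ Integrable (fun x => Real.log ((Tm lam ω ε ν).rnDeriv ω x).toReal) (Tm lam ω ε ν) := by
  have hac : (Tm lam ω ε ν) ≪ ω := tilted_absolutelyContinuous _ _
  refine ⟨hac, ?_⟩
  have := hac.ae_le (log_rnDeriv_tilted_left_self (intg (expcont (cont_We lam ε ν)) ω))
  have hp : IsProbabilityMeasure (Tm lam ω ε ν) := prob_Tm ν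
  exact (integrable_congr this).2 (intg ((cont_We lam ε ν).sub continuous_const) _)

lemma EA_T [IsProbabilityMeasure ω] (hε : 0 < ε) (ν : Measure (Sph d)) [IsProbabilityMeasure ν] :
    EA lam ω ε (Tm lam ω ε ν) = ((∫ x, WA lam ν x ∂(Tm lam ω ε ν) - ε * log (Zf lam ω ε ν)
      - IA lam (Tm lam ω ε ν) / 2 : ℝ) : EReal) := by
  have hp : IsProbabilityMeasure (Tm lam ω ε ν) := prob_Tm ν
  rw [EA_fin (fin_T ν), llr_T hε _ ν (fin_T ν), InformationTheory.klDiv_self]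
  simp

lemma EA_T_le [IsProbabilityMeasure ω] (h : Good lam o l2) (hε : 0 < ε) (ν : Measure (Sph d))
    [IsProbabilityMeasure ν] :
    EA lam ω ε (Tm lam ω ε ν) ≤ (Jf lam ω ε ν : EReal) := by
  have hp : IsProbabilityMeasure (Tm lam ω ε ν) := prob_Tm ν
  rw [EA_T hε, EReal.coe_le_coe_iff, Jf]
  have := posdef h (Tm lam ω ε ν) ν
  linarith

lemma gibbs_of_le [IsProbabilityMeasure ω] (hε : 0 < ε) (μ : Measure (Sph d))
    [IsProbabilityMeasure μ] (hle : EA lam ω ε μ ≤ (Jf lam ω ε μ : EReal)) : IsGibbs lam ω ε μ := by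
  have hp : IsProbabilityMeasure (Tm lam ω ε μ) := prob_Tm μ
  have hac : ω ≪ Tm lam ω ε μ := absolutelyContinuous_tilted (intg (expcont (cont_We lam ε μ)) ω)
  refine ⟨inferInstance, ?_⟩
  change μ = Tm lam ω ε μ
  by_cases h : μ ≪ ω ∧ Integrable (fun x => Real.log (μ.rnDeriv ω x).toReal) μ
  · rw [EA_fin h, EReal.coe_le_coe_iff, llr_T (lam := lam) hε μ μ h, Jf, ← IA_eq] at hle
    have h0 : ε * (InformationTheory.klDiv μ (Tm lam ω ε μ)).toReal ≤ 0 := by linarith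
    have h1 : (InformationTheory.klDiv μ (Tm lam ω ε μ)).toReal = 0 := by
      have : 0 ≤ (InformationTheory.klDiv μ (Tm lam ω ε μ)).toReal := ENNReal.toReal_nonneg
      nlinarith
    rw [ENNReal.toReal_eq_zero_iff] at h1
    rcases h1 with h1 | h1
    · exact InformationTheory.klDiv_eq_zero_iff.1 h1
    · exfalso
      refine InformationTheory.klDiv_ne_top (h.1.trans hac) ?_ h1
      exact integrable_llr_tilted_right h.1 (intg (cont_We lam ε μ) μ) h.2
        (intg (expcont (cont_We lam ε μ)) ω)
  · rw [EA_top hε h] at hle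
    exact absurd hle (by simp)

lemma EA_gibbs [IsProbabilityMeasure ω] (hε : 0 < ε) {μ : Measure (Sph d)} (hg : IsGibbs lam ω ε μ) :
    EA lam ω ε μ = (Jf lam ω ε μ : EReal) := by
  have := hg.1
  have h1 : μ = Tm lam ω ε μ := hg.2
  have h2 := EA_T (lam := lam) (ω := ω) hε μ
  rw [← h1] at h2
  rw [h2, Jf, ← IA_eq]
  congr 1; ring

/-- entropy nonnegative: for Gibbs measures. -/
lemma gibbs_log_le [IsProbabilityMeasure ω] (hε : 0 < ε) {μ : Measure (Sph d)} (hg : IsGibbs lam ω ε μ) :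
    ε * log (Zf lam ω ε μ) ≤ IA lam μ := by
  have := hg.1
  have h1 : μ = Tm lam ω ε μ := hg.2
  have hf := fin_T (lam := lam) (ω := ω) (ε := ε) μ
  rw [← h1] at hf
  have h2 := llr_T (lam := lam) hε μ μ hf
  rw [← IA_eq, ← h1, InformationTheory.klDiv_self] at h2
  have h3 := InformationTheory.integral_llr_add_sub_measure_univ_nonneg hf.1 hf.2
  simp only [probReal_univ, add_sub_cancel_right] at h3
  have : 0 ≤ ε * ∫ x, llr μ ω x ∂μ := mul_nonneg hε.le h3
  simp at h2
  linarith
end energy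


section weak
variable {lam : Fin d → ℝ} {o : Fin d} {l2 : ℝ} {ω : Measure (Sph d)} {ε : ℝ}

lemma weak_lim (h : Good lam o l2) (μ : ℕ → Measure (Sph d)) (hμ : ∀ n, IsProbabilityMeasure (μ n)) :
    ∃ ν : Measure (Sph d), IsProbabilityMeasure ν ∧
      (∀ g : Sph d → ℝ, Continuous g →
        Tendsto (fun n => ∫ x, g x ∂(μ n)) (hyperfilter ℕ : Filter ℕ) (𝓝 (∫ x, g x ∂ν))) ∧
      (∀ η > 0, ∀ᶠ n in (hyperfilter ℕ : Filter ℕ), ∀ x, |WA lam (μ n) x - WA lam ν x| ≤ η) ∧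
      Tendsto (fun n => IA lam (μ n)) (hyperfilter ℕ : Filter ℕ) (𝓝 (IA lam ν)) := by
  let P : ℕ → ProbabilityMeasure (Sph d) := fun n => ⟨μ n, hμ n⟩
  obtain ⟨ν, -, hν⟩ := isCompact_univ.ultrafilter_le_nhds ((hyperfilter ℕ).map P) (by simp)
  have hT : Tendsto P (hyperfilter ℕ : Filter ℕ) (𝓝 ν) := hν
  have hg : ∀ g : Sph d → ℝ, Continuous g →
        Tendsto (fun n => ∫ x, g x ∂(μ n)) (hyperfilter ℕ : Filter ℕ) (𝓝 (∫ x, g x ∂(ν : Measure (Sph d)))) := by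
    intro g hg
    have := (ProbabilityMeasure.tendsto_iff_forall_integral_tendsto.1 hT)
      (BoundedContinuousFunction.mkOfCompact ⟨g, hg⟩)
    simpa [P] using this
  have hun : ∀ η > 0, ∀ᶠ n in (hyperfilter ℕ : Filter ℕ), ∀ x, |WA lam (μ n) x - WA lam (ν : Measure (Sph d)) x| ≤ η := by
    intro η hη
    have hL := Lc_pos h
    obtain ⟨t, -, htf, ht⟩ := (isCompact_univ (X := Sph d)).finite_cover_balls (e := η / (4 * Lc lam o)) (by positivity)
    have h1 : ∀ᶠ n in (hyperfilter ℕ : Filter ℕ), ∀ c ∈ t, |WA lam (μ n) c - WA lam (ν : Measure (Sph d)) c| < η / 2 := by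
      rw [eventually_all_finite htf]
      intro c _
      have := hg _ (cont_K2 lam c)
      have := (tendsto_iff_dist_tendsto_zero.1 this).eventually (gt_mem_nhds (half_pos hη))
      exact this
    filter_upwards [h1] with n hn x
    have hx := ht (Set.mem_univ x)
    simp only [Set.mem_iUnion, Metric.mem_ball] at hx
    obtain ⟨c, hc, hxc⟩ := hx
    have := hμ n
    have a1 := W_lip h (μ n) x c
    have a2 := W_lip h (ν : Measure (Sph d)) x c
    have a3 := hn c hc
    have a4 : Lc lam o * dist x c ≤ η / 4 := by
      calc Lc lam o * dist x c ≤ Lc lam o * (η / (4 * Lc lam o)) := by gcongr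
        _ = η / 4 := by field_simp
    rw [abs_le] at *
    rw [abs_lt] at a3
    constructor <;> linarith [a1.1, a1.2, a2.1, a2.2, a3.1, a3.2]
  refine ⟨ν, inferInstance, hg, hun, ?_⟩
  have h2 := hg _ (cont_W lam (ν : Measure (Sph d)))
  rw [← IA_eq] at h2
  rw [Metric.tendsto_nhds] at h2 ⊢
  intro e he
  filter_upwards [h2 (e/2) (half_pos he), hun (e/4) (by positivity)] with n hn1 hn2
  have := hμ n
  rw [Real.dist_eq] at *
  have h3 : |∫ x, (WA lam (μ n) x - WA lam (ν : Measure (Sph d)) x) ∂(μ n)| ≤ e / 4 := by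
    have := norm_integral_le_of_norm_le_const (μ := μ n) (f := fun x => WA lam (μ n) x - WA lam (ν : Measure (Sph d)) x)
      (ae_of_all _ fun y => hn2 y)
    simpa using this
  rw [integral_sub (intg (cont_W lam _) _) (intg (cont_W lam _) _), ← IA_eq] at h3
  rw [abs_le] at h3
  rw [abs_lt] at hn1 ⊢
  constructor <;> linarith [h3.1, h3.2, hn1.1, hn1.2]

lemma mEps_le (μ : Measure (Sph d)) [IsProbabilityMeasure μ] : mEps lam ω ε ≤ EA lam ω ε μ :=
  sInf_le ⟨μ, inferInstance, rfl⟩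

/-- existence of a Gibbs minimizer -/
lemma exists_min [IsProbabilityMeasure ω] (h : Good lam o l2) (hε : 0 < ε) :
    ∃ μ : Measure (Sph d), IsGibbs lam ω ε μ ∧ EA lam ω ε μ = mEps lam ω ε := by
  have hne : {r : EReal | ∃ μ : Measure (Sph d), IsProbabilityMeasure μ ∧ EA lam ω ε μ = r}.Nonempty :=
    ⟨_, ω, inferInstance, rfl⟩
  obtain ⟨u, -, hu, hmem⟩ := exists_seq_tendsto_sInf hne (OrderBot.bddBelow _)
  choose μ hμ hμu using hmem
  obtain ⟨ν, hν, hg, -, hI⟩ := weak_lim h μ hμ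
  have hJ : (Jf lam ω ε ν : EReal) ≤ mEps lam ω ε := by
    have h1 : Tendsto (fun n => ((∫ x, WA lam ν x ∂(μ n) - ε * log (Zf lam ω ε ν) - IA lam (μ n) / 2 : ℝ) : EReal))
        (hyperfilter ℕ : Filter ℕ) (𝓝 ((IA lam ν - ε * log (Zf lam ω ε ν) - IA lam ν / 2 : ℝ) : EReal)) := by
      apply (continuous_coe_real_ereal.tendsto _).comp
      exact ((hg _ (cont_W lam ν)).sub_const _).sub (hI.div_const 2)
    have h2 : Tendsto u (hyperfilter ℕ : Filter ℕ) (𝓝 (mEps lam ω ε)) := by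
      refine hu.mono_left ?_
      rw [← Nat.cofinite_eq_atTop]; exact hyperfilter_le_cofinite
    have h3 := le_of_tendsto_of_tendsto' h1 h2 (fun n => by
      rw [← hμu n]
      have := hμ n
      exact EA_ge hε (μ n) ν)
    convert h3 using 2
    rw [Jf]; ring
  have hp : IsProbabilityMeasure (Tm lam ω ε ν) := prob_Tm ν
  have hE : EA lam ω ε (Tm lam ω ε ν) = mEps lam ω ε :=
    le_antisymm ((EA_T_le h hε ν).trans hJ) (mEps_le _)
  refine ⟨Tm lam ω ε ν, ?_, hE⟩
  apply gibbs_of_le hε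
  rw [hE]
  have hp : IsProbabilityMeasure (Tm lam ω ε (Tm lam ω ε ν)) := prob_Tm _
  exact (mEps_le _).trans (EA_T_le h hε _)

/-- lower bound for log Z: uniform in the measure and the point -/
lemma logZ_lower (h : Good lam o l2) (hω : IsUniform ω) {η : ℝ} (hη : 0 < η) :
    ∃ ε0 > 0, ∀ ε, 0 < ε → ε < ε0 → ∀ μ : Measure (Sph d), IsProbabilityMeasure μ → ∀ x,
      WA lam μ x - η ≤ ε * log (Zf lam ω ε μ) := by
  have := hω.1
  have hL := Lc_pos h
  obtain ⟨c, hc, hb⟩ := omega_ball hω (ρ := η / (2 * Lc lam o)) (by positivity)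
  refine ⟨η / (2 * (1 + |log c|)), by positivity, fun ε h0 h1 μ hμ x => ?_⟩
  have hz := Z_lower (ω := ω) (cont_We lam ε μ) (Metric.ball x (η / (2 * Lc lam o))) measurableSet_ball
    ((WA lam μ x - η / 2) / ε) (by
      intro y hy
      have := W_lip h μ y x
      have hy : dist y x < η / (2 * Lc lam o) := hy
      have a4 : Lc lam o * dist y x ≤ η / 2 := by
        calc Lc lam o * dist y x ≤ Lc lam o * (η / (2 * Lc lam o)) := by gcongr
          _ = η / 2 := by field_simp
      gcongr
      linarith [(abs_le.1 this).1])
  rw [hb] at hz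
  have h2 := log_le_log (by positivity) hz
  rw [log_mul (exp_pos _).ne' hc.ne', log_exp] at h2
  have h3 : ε * ((WA lam μ x - η / 2) / ε + log c) ≤ ε * log (Zf lam ω ε μ) := by
    unfold Zf; gcongr
  have h4 : ε * ((WA lam μ x - η / 2) / ε + log c) = WA lam μ x - η / 2 + ε * log c := by
    field_simp
  have h5 : ε * |log c| ≤ η / 2 := by
    rw [lt_div_iff₀ (by positivity)] at h1
    nlinarith [abs_nonneg (log c)]
  have h6 : - |log c| ≤ log c := neg_abs_le _
  nlinarith

lemma q_pt (o : Fin d) : qA lam (pt o).1 (pt o).1 = lam o := by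
  unfold qA
  rw [Finset.sum_eq_single o]
  · simp [pt_same]
  · intro b _ hb; simp [pt_ne hb]
  · simp

lemma min_upper (h : Good lam o l2) (hω : IsUniform ω) {η : ℝ} (hη : 0 < η) :
    ∃ ε0 > 0, ∀ ε, 0 < ε → ε < ε0 → mEps lam ω ε ≤ ((-(exp (lam o)) / 2 + η : ℝ) : EReal) := by
  obtain ⟨ε0, h0, hh⟩ := logZ_lower h hω hη
  refine ⟨ε0, h0, fun ε h1 h2 => ?_⟩
  have := hω.1
  have hp : IsProbabilityMeasure (Tm lam ω ε (Measure.dirac (pt o))) := prob_Tm _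
  refine (mEps_le (Tm lam ω ε (Measure.dirac (pt o)))).trans ((EA_T_le h h1 _).trans ?_)
  rw [EReal.coe_le_coe_iff, Jf]
  have h3 := hh ε h1 h2 (Measure.dirac (pt o)) inferInstance (pt o)
  have h4 : WA lam (Measure.dirac (pt o)) (pt o) = exp (lam o) := by
    simp [WA, Kker, q_pt]
  have h5 : IA lam (Measure.dirac (pt o)) = exp (lam o) := by
    simp [IA, Kker, q_pt]
  rw [h4] at h3; rw [h5]; linarith
end weak


section limit
variable {lam : Fin d → ℝ} {o : Fin d} {l2 : ℝ} {ω : Measure (Sph d)} {ε : ℝ}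

lemma contK2' (lam : Fin d → ℝ) (x : Sph d) (i : Fin d) : Continuous (fun y : Sph d => y.1 i * Kker lam x y) :=
  (cont_co i).mul (cont_K2 lam x)

lemma iadd (μ : Measure (Sph d)) [IsFiniteMeasure μ] {f g : Sph d → ℝ} (hf : Continuous f) (hg : Continuous g) :
    ∫ x, (f x + g x) ∂μ = ∫ x, f x ∂μ + ∫ x, g x ∂μ := integral_add (intg hf μ) (intg hg μ)

lemma isub (μ : Measure (Sph d)) [IsFiniteMeasure μ] {f g : Sph d → ℝ} (hf : Continuous f) (hg : Continuous g) :
    ∫ x, (f x - g x) ∂μ = ∫ x, f x ∂μ - ∫ x, g x ∂μ := integral_sub (intg hf μ) (intg hg μ)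

lemma imono (μ : Measure (Sph d)) [IsFiniteMeasure μ] {f g : Sph d → ℝ} (hf : Continuous f) (hg : Continuous g)
    (hfg : ∀ x, f x ≤ g x) : ∫ x, f x ∂μ ≤ ∫ x, g x ∂μ := integral_mono (intg hf μ) (intg hg μ) hfg

lemma K_pole (y z : Sph d) (s : ℝ) (hs : s ^ 2 = 1) (hy : y.1 o = s) : Kker lam y z = exp (lam o * s * z.1 o) := by
  unfold Kker qA
  rw [Finset.sum_eq_single o, hy]
  · intro i _ hi
    have h1 := sum_ne_sq o y
    rw [hy, hs, sub_self] at h1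
    have h2 := (Finset.sum_eq_zero_iff_of_nonneg (fun j _ => sq_nonneg _)).1 h1 i (by simp [hi])
    have h3 : y.1 i = 0 := by simpa using h2
    rw [h3]; ring
  · simp

lemma limit_struct (h : Good lam o l2) (ν : Measure (Sph d)) [IsProbabilityMeasure ν]
    (hW : ∀ x, WA lam ν x ≤ IA lam ν) (h1 : exp l2 < IA lam ν) (h2 : cosh (lam o) < IA lam ν) :
    ∫ x, aa o x ∂ν = 0 ∨ ∫ x : Sph d, (1 + x.1 o) ∂ν = 0 := by
  set M := IA lam ν with hM
  have hM1 : 1 < M := (one_le_cosh _).trans_lt h2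
  have hae : ∀ᵐ y ∂ν, WA lam ν y = M := by
    have h3 : ∫ x, (M - WA lam ν x) ∂ν = 0 := by
      rw [integral_sub (integrable_const _) (intg (cont_W lam ν) ν), ← IA_eq]; simp [hM]
    rw [integral_eq_zero_iff_of_nonneg (fun x => by simpa using hW x)
      (intg (by fun_prop) ν)] at h3
    filter_upwards [h3] with y hy
    simp at hy; linarith
  have hcomp : IsCompact {y | WA lam ν y = M} :=
    (isClosed_eq (cont_W lam ν) continuous_const).isCompact
  have hne : {y | WA lam ν y = M}.Nonempty := hae.exists
  obtain ⟨x, hxS, hxmin⟩ := hcomp.exists_isMinOn hne (f := fun y : Sph d => (y.1 o)^2) (by fun_prop)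
  have hxS : WA lam ν x = M := hxS
  have hmin : ∀ y, WA lam ν y = M → (x.1 o)^2 ≤ (y.1 o)^2 := fun y hy => hxmin hy
  -- the gradient
  let g : Fin d → ℝ := fun i => lam i * ∫ y : Sph d, y.1 i * Kker lam x y ∂ν
  have hlin : ∀ z : EuclideanSpace ℝ (Fin d), ∫ y : Sph d, Kker lam x y * qA lam z y.1 ∂ν = ∑ i, g i * z i := by
    intro z
    simp only [qA, Finset.mul_sum, g]
    rw [integral_finsetSum _ (fun i _ => by
      apply intg
      have := cont_K2 lam x
      fun_prop)]
    apply Finset.sum_congr rfl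
    intro i _
    rw [← integral_const_mul, ← integral_mul_const]
    congr 1; ext y; ring
  have cq : ∀ z : EuclideanSpace ℝ (Fin d), Continuous (fun y : Sph d => Kker lam x y * qA lam z y.1) := by
    intro z
    have := cont_K2 lam x
    unfold qA; fun_prop
  set c := ∑ i, g i * x.1 i with hc
  have hgz : ∀ z : Sph d, ∑ i, g i * z.1 i ≤ c := by
    intro z
    have h3 : ∫ y, (Kker lam x y + (Kker lam x y * qA lam z.1 y.1 - Kker lam x y * qA lam x.1 y.1)) ∂ν ≤ WA lam ν z := by
      apply integral_mono _ (intg (cont_K2 lam z) ν)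
      · intro y
        simp only [Kker]
        have h4 := add_one_le_exp (qA lam z.1 y.1 - qA lam x.1 y.1)
        have h5 : exp (qA lam z.1 y.1) = exp (qA lam x.1 y.1) * exp (qA lam z.1 y.1 - qA lam x.1 y.1) := by
          rw [← exp_add]; ring_nf
        rw [h5]
        have := exp_pos (qA lam x.1 y.1)
        nlinarith
      · exact intg ((cont_K2 lam x).add ((cq _).sub (cq _))) ν
    have hcc : Continuous (fun y : Sph d => Kker lam x y * qA lam z.1 y.1 - Kker lam x y * qA lam x.1 y.1) :=
      (cq _).sub (cq _)
    rw [iadd ν (cont_K2 lam x) hcc, isub ν (cq _) (cq _), hlin, hlin] at h3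
    have h4 : ∫ y, Kker lam x y ∂ν = M := hxS
    have := hW z
    linarith
  have hcM : M * log M ≤ c := by
    rw [hc, ← hlin]
    have h3 : ∫ y, (Kker lam x y * (1 + log M) - M) ∂ν ≤ ∫ y : Sph d, Kker lam x y * qA lam x.1 y.1 ∂ν := by
      apply integral_mono _ (intg (cq _) ν)
      · intro y
        simp only [Kker]
        have h4 := add_one_le_exp (log M - qA lam x.1 y.1)
        have h5 : M = exp (qA lam x.1 y.1) * exp (log M - qA lam x.1 y.1) := by
          rw [← exp_add, add_sub_cancel, exp_log (by linarith)]
        have := exp_pos (qA lam x.1 y.1)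
        nlinarith
      · exact intg (((cont_K2 lam x).mul continuous_const).sub continuous_const) ν
    have hcc : Continuous (fun y : Sph d => Kker lam x y * (1 + log M)) :=
      (cont_K2 lam x).mul continuous_const
    rw [isub ν hcc continuous_const, integral_mul_const] at h3
    have h4 : ∫ y, Kker lam x y ∂ν = M := hxS
    rw [h4] at h3
    simp at h3
    linarith
  have hlogM : 0 < log M := log_pos hM1
  have hc0 : 0 < c := lt_of_lt_of_le (by positivity) hcM
  have hgx : ∀ i, g i = c * x.1 i := by
    set G : EuclideanSpace ℝ (Fin d) := WithLp.toLp 2 g with hG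
    have hGi : ∀ i, G i = g i := fun i => rfl
    have hinner : ∀ z : EuclideanSpace ℝ (Fin d), inner ℝ G z = ∑ i, g i * z i := by
      intro z; rw [PiLp.inner_apply]; apply Finset.sum_congr rfl; intro i _; simp [hGi, mul_comm]
    have hGne : G ≠ 0 := by
      intro h0
      have := hinner x.1
      rw [h0, inner_zero_left, ← hc] at this
      linarith
    have hGn : 0 < ‖G‖ := norm_pos_iff.2 hGne
    have h5 : ‖G‖ ≤ c := by
      have := hgz ⟨(‖G‖⁻¹) • G, by simp [norm_smul, hGn.ne']⟩
      rw [← hinner] at this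
      simp only [inner_smul_right, real_inner_self_eq_norm_sq] at this
      calc ‖G‖ = ‖G‖⁻¹ * ‖G‖^2 := by field_simp
        _ ≤ c := this
    have h6 : ‖G - c • x.1‖^2 ≤ 0 := by
      rw [@norm_sub_sq_real, inner_smul_right, hinner, ← hc, norm_smul, nrm, Real.norm_of_nonneg hc0.le]
      nlinarith
    have h7 : G - c • x.1 = 0 := by
      rw [← norm_eq_zero]; nlinarith [norm_nonneg (G - c • x.1)]
    intro i
    have h8 : G = c • x.1 := sub_eq_zero.1 h7
    rw [← hGi, h8]; simp
  have hx1 : (x.1 o)^2 = 1 := by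
    by_contra hne1
    have hp : 0 < 1 - (x.1 o)^2 := by
      have := co_sq_le x o
      have := lt_of_le_of_ne this hne1
      linarith
    have h3 : c * (1 - (x.1 o)^2) = ∫ y : Sph d, Kker lam x y * ∑ i ∈ Finset.univ.erase o, lam i * x.1 i * y.1 i ∂ν := by
      rw [← sum_ne_sq, Finset.mul_sum]
      simp only [Finset.mul_sum]
      rw [integral_finsetSum _ (fun i _ => by
        apply intg
        have := cont_K2 lam x
        fun_prop)]
      apply Finset.sum_congr rfl
      intro i _
      have : c * x.1 i ^ 2 = x.1 i * g i := by rw [hgx i]; ring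
      rw [this]
      simp only [g]
      rw [← integral_const_mul, ← integral_const_mul]
      congr 1; ext y; ring
    have h4 : ∫ y : Sph d, Kker lam x y * ∑ i ∈ Finset.univ.erase o, lam i * x.1 i * y.1 i ∂ν
        ≤ ∫ y : Sph d, Kker lam x y * (l2 * (1 - (x.1 o)^2)) ∂ν := by
      apply integral_mono_ae
      · apply intg
        have := cont_K2 lam x
        fun_prop
      · exact intg ((cont_K2 lam x).mul continuous_const) ν
      · filter_upwards [hae] with y hy
        have hy1 := hmin y hy
        refine mul_le_mul_of_nonneg_left ?_ (K_pos lam x y).le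
        have h5 : ∑ i ∈ Finset.univ.erase o, lam i * x.1 i * y.1 i ≤
            ∑ i ∈ Finset.univ.erase o, l2 * ((x.1 i ^ 2 + y.1 i ^ 2) / 2) := by
          apply Finset.sum_le_sum
          intro i hi
          have hi : i ≠ o := by simpa using hi
          have a1 := h.pos i
          have a2 := h.le2 i hi
          nlinarith [sq_nonneg (x.1 i - y.1 i), sq_nonneg (x.1 i), sq_nonneg (y.1 i)]
        rw [← Finset.mul_sum, ← Finset.sum_div, Finset.sum_add_distrib, sum_ne_sq, sum_ne_sq] at h5
        have hl2 : 0 ≤ l2 ∨ Finset.univ.erase o = (∅ : Finset (Fin d)) := by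
          rcases (Finset.univ.erase o).eq_empty_or_nonempty with h6 | ⟨j, hj⟩
          · right; exact h6
          · left; exact (h.pos j).le.trans (h.le2 j (by simpa using hj))
        rcases hl2 with hl2 | hl2
        · refine h5.trans (mul_le_mul_of_nonneg_left (by linarith) hl2)
        · have := sum_ne_sq o x
          rw [hl2] at this; simp at this; linarith
    rw [integral_mul_const] at h4
    have h5 : ∫ y, Kker lam x y ∂ν = M := hxS
    rw [h5, ← h3] at h4
    have h6 : c ≤ M * l2 := by
      by_contra hh
      push Not at hh
      nlinarith
    have h7 : log M ≤ l2 := by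
      by_contra hh
      push Not at hh
      nlinarith
    have h8 := exp_le_exp.2 h7
    rw [exp_log (by linarith)] at h8
    linarith
  have hpole : ∀ y, WA lam ν y = M → y.1 o = 1 ∨ y.1 o = -1 := by
    intro y hy
    have := hmin y hy
    have h3 : (y.1 o)^2 = 1 := le_antisymm (co_sq_le y o) (by rw [hx1] at this; exact this)
    have h4 : (y.1 o - 1) * (y.1 o + 1) = 0 := by linarith
    rcases mul_eq_zero.1 h4 with h5 | h5
    · left; linarith
    · right; linarith
  by_cases hplus : ∃ y, WA lam ν y = M ∧ y.1 o = 1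
  · by_cases hminus : ∃ y, WA lam ν y = M ∧ y.1 o = -1
    · exfalso
      obtain ⟨y, hy, hy1⟩ := hplus
      obtain ⟨z, hz, hz1⟩ := hminus
      have h3 : ∫ w, (Kker lam y w + Kker lam z w) ∂ν ≤ ∫ w : Sph d, 2 * cosh (lam o) ∂ν := by
        apply integral_mono (intg ((cont_K2 lam y).add (cont_K2 lam z)) ν) (integrable_const _)
        intro w
        change Kker lam y w + Kker lam z w ≤ 2 * cosh (lam o)
        rw [K_pole y w 1 (by norm_num) hy1, K_pole z w (-1) (by norm_num) hz1]
        have h4 : cosh (lam o * w.1 o) ≤ cosh (lam o) := by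
          rw [cosh_le_cosh, abs_mul]
          have := co_abs_le w o
          have := abs_nonneg (lam o)
          nlinarith
        rw [cosh_eq] at h4
        simp only [mul_one, mul_neg, neg_mul] at *
        linarith
      rw [integral_add (intg (cont_K2 lam y) ν) (intg (cont_K2 lam z) ν)] at h3
      have h5 : ∫ w, Kker lam y w ∂ν = M := hy
      have h6 : ∫ w, Kker lam z w ∂ν = M := hz
      rw [h5, h6] at h3
      simp at h3
      linarith
    · left
      rw [integral_eq_zero_iff_of_nonneg (fun x => aa_nonneg o x) (intg (cont_aa o) ν)]
      filter_upwards [hae] with y hy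
      rcases hpole y hy with h3 | h3
      · simp [aa, h3]
      · exact absurd ⟨y, hy, h3⟩ hminus
  · right
    rw [integral_eq_zero_iff_of_nonneg (fun x => by have := neg_le_co x o; simp; linarith) (intg (by fun_prop) ν)]
    filter_upwards [hae] with y hy
    rcases hpole y hy with h3 | h3
    · exact absurd ⟨y, hy, h3⟩ hplus
    · simp [h3]

/-- localization -/
lemma localize (h : Good lam o l2) (hω : IsUniform ω) {δ η : ℝ} (hδ : 0 < δ) (hη : 0 < η) :
    ∃ ε0 > 0, ∀ ε, 0 < ε → ε < ε0 → ∀ μ : Measure (Sph d), IsGibbs lam ω ε μ →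
      max (exp l2) (cosh (lam o)) + η ≤ IA lam μ →
      ∫ x, aa o x ∂μ ≤ δ ∨ ∫ x : Sph d, (1 + x.1 o) ∂μ ≤ δ := by
  by_contra hcon
  push Not at hcon
  have := hω.1
  have hseq : ∀ n : ℕ, ∃ ε μ, 0 < ε ∧ (∀ x, WA lam μ x - 1 / ((n : ℝ) + 1) ≤ ε * log (Zf lam ω ε μ)) ∧
      IsGibbs lam ω ε μ ∧ max (exp l2) (cosh (lam o)) + η ≤ IA lam μ ∧
      δ < ∫ x, aa o x ∂μ ∧ δ < ∫ x : Sph d, (1 + x.1 o) ∂μ := by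
    intro n
    obtain ⟨ε0, h0, hh⟩ := logZ_lower h hω (η := 1 / ((n:ℝ) + 1)) (by positivity)
    obtain ⟨ε, e1, e2, μ, hg, hI, hd⟩ := hcon ε0 h0
    exact ⟨ε, μ, e1, hh ε e1 e2 μ hg.1, hg, hI, hd⟩
  choose ε μ h1 h2 h3 h4 h5 h6 using hseq
  obtain ⟨ν, hν, hg, hun, hI⟩ := weak_lim h μ (fun n => (h3 n).1)
  have hM : max (exp l2) (cosh (lam o)) + η ≤ IA lam ν := ge_of_tendsto' hI h4
  have hW : ∀ x, WA lam ν x ≤ IA lam ν := by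
    intro x
    have hlim : Tendsto (fun n : ℕ => WA lam (μ n) x - 1 / ((n : ℝ) + 1)) (hyperfilter ℕ : Filter ℕ)
        (𝓝 (WA lam ν x - 0)) := by
      refine (hg _ (cont_K2 lam x)).sub ?_
      refine tendsto_one_div_add_atTop_nhds_zero_nat.mono_left ?_
      rw [← Nat.cofinite_eq_atTop]; exact hyperfilter_le_cofinite
    rw [sub_zero] at hlim
    exact le_of_tendsto_of_tendsto' hlim hI (fun n => (h2 n x).trans (gibbs_log_le (h1 n) (h3 n)))
  have a1 : δ ≤ ∫ x, aa o x ∂ν := ge_of_tendsto' (hg _ (cont_aa o)) (fun n => (h5 n).le)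
  have a2 : δ ≤ ∫ x : Sph d, (1 + x.1 o) ∂ν :=
    ge_of_tendsto' (hg (fun x : Sph d => 1 + x.1 o) (by fun_prop)) (fun n => (h6 n).le)
  rcases limit_struct h ν hW (by linarith [le_max_left (exp l2) (cosh (lam o))])
    (by linarith [le_max_right (exp l2) (cosh (lam o))]) with h7 | h7 <;> linarith
end limit


section antipode
variable {lam : Fin d → ℝ} {o : Fin d} {l2 : ℝ} {ω : Measure (Sph d)} {ε : ℝ}

def sneg (d : ℕ) : Sph d → Sph d := sphMap (LinearIsometryEquiv.neg ℝ)

lemma sneg_co (x : Sph d) (i : Fin d) : (sneg d x).1 i = - x.1 i := by simp [sneg, sphMap]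

lemma cont_sneg : Continuous (sneg d) := cont_sphMap _

lemma K_sneg (x y : Sph d) : Kker lam (sneg d x) (sneg d y) = Kker lam x y := by
  unfold Kker qA; congr 1; apply Finset.sum_congr rfl; intro i _; rw [sneg_co, sneg_co]; ring

lemma W_sneg (μ : Measure (Sph d)) [IsFiniteMeasure μ] (x : Sph d) :
    WA lam (μ.map (sneg d)) (sneg d x) = WA lam μ x := by
  unfold WA
  rw [integral_map cont_sneg.measurable.aemeasurable (cont_K2 lam _).aestronglyMeasurable]
  simp only [K_sneg]

lemma prob_sneg (μ : Measure (Sph d)) [IsProbabilityMeasure μ] : IsProbabilityMeasure (μ.map (sneg d)) :=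
  Measure.isProbabilityMeasure_map cont_sneg.measurable.aemeasurable

lemma IA_sneg (μ : Measure (Sph d)) [IsProbabilityMeasure μ] : IA lam (μ.map (sneg d)) = IA lam μ := by
  have := prob_sneg μ
  rw [IA_eq, integral_map cont_sneg.measurable.aemeasurable (cont_W lam _).aestronglyMeasurable]
  simp only [W_sneg]; rfl

lemma Zf_sneg (hω : IsUniform ω) (μ : Measure (Sph d)) [IsProbabilityMeasure μ] :
    Zf lam ω ε (μ.map (sneg d)) = Zf lam ω ε μ := by
  have := prob_sneg μ
  have h1 : ω.map (sneg d) = ω := hω.2 _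
  unfold Zf
  conv_lhs => rw [← h1]
  rw [integral_map cont_sneg.measurable.aemeasurable (expcont (cont_We lam ε _)).aestronglyMeasurable]
  simp only [W_sneg]

lemma gibbs_sneg (hω : IsUniform ω) {μ : Measure (Sph d)} (hg : IsGibbs lam ω ε μ) :
    IsGibbs lam ω ε (μ.map (sneg d)) := by
  have := hg.1
  have hp := prob_sneg μ
  have h1 : ω.map (sneg d) = ω := hω.2 _
  refine ⟨hp, ?_⟩
  have hz := Zf_sneg (lam := lam) (ε := ε) hω μ
  unfold Zf at hz
  rw [hz]
  ext E hE
  rw [Measure.map_apply cont_sneg.measurable hE, withDensity_apply _ hE]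
  conv_lhs => rw [hg.2]
  conv_rhs => rw [← h1]
  rw [withDensity_apply _ (cont_sneg.measurable hE), setLIntegral_map hE _ cont_sneg.measurable]
  · simp only [W_sneg, h1]
  · exact (((expcont (cont_We lam ε _)).div_const _).measurable).ennreal_ofReal

lemma Jf_sneg (hω : IsUniform ω) (μ : Measure (Sph d)) [IsProbabilityMeasure μ] :
    Jf lam ω ε (μ.map (sneg d)) = Jf lam ω ε μ := by
  unfold Jf; rw [IA_sneg, Zf_sneg hω]

lemma aa_sneg (μ : Measure (Sph d)) [IsProbabilityMeasure μ] :
    ∫ x, aa o x ∂(μ.map (sneg d)) = ∫ x : Sph d, (1 + x.1 o) ∂μ := by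
  rw [integral_map cont_sneg.measurable.aemeasurable (cont_aa o).aestronglyMeasurable]
  simp [aa, sneg_co]
end antipode

section rot
variable {lam : Fin d → ℝ} {o : Fin d} {l2 : ℝ} {ω : Measure (Sph d)} {ε : ℝ}

def rotv (o i : Fin d) (θ : ℝ) (x : EuclideanSpace ℝ (Fin d)) : EuclideanSpace ℝ (Fin d) :=
  WithLp.toLp 2 (fun j => if j = o then cos θ * x o - sin θ * x i else
    if j = i then sin θ * x o + cos θ * x i else x j)

lemma rotv_norm {o i : Fin d} (hi : i ≠ o) (θ : ℝ) (x : EuclideanSpace ℝ (Fin d)) : ‖rotv o i θ x‖ = ‖x‖ := by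
  have : ‖rotv o i θ x‖^2 = ‖x‖^2 := by
    rw [EuclideanSpace.real_norm_sq_eq, EuclideanSpace.real_norm_sq_eq]
    rw [← Finset.add_sum_erase _ _ (Finset.mem_univ o),
      ← Finset.add_sum_erase _ _ (show i ∈ Finset.univ.erase o by simp [hi])]
    rw [← Finset.add_sum_erase Finset.univ (fun j => x j ^ 2) (Finset.mem_univ o),
      ← Finset.add_sum_erase _ (fun j => x j ^ 2) (show i ∈ Finset.univ.erase o by simp [hi])]
    have h1 : ∑ j ∈ (Finset.univ.erase o).erase i, (rotv o i θ x) j ^ 2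
        = ∑ j ∈ (Finset.univ.erase o).erase i, x j ^ 2 := by
      apply Finset.sum_congr rfl
      intro j hj
      simp only [Finset.mem_erase] at hj
      simp [rotv, hj.1, hj.2.1]
    rw [h1]
    have h2 : rotv o i θ x o = cos θ * x o - sin θ * x i := by simp [rotv]
    have h3 : rotv o i θ x i = sin θ * x o + cos θ * x i := by simp [rotv, hi]
    rw [h2, h3]
    have := sin_sq_add_cos_sq θ
    linear_combination (x o ^ 2 + x i ^ 2) * this
  exact (pow_left_inj₀ (norm_nonneg _) (norm_nonneg _) two_ne_zero).1 this

def rotE {o i : Fin d} (hi : i ≠ o) (θ : ℝ) : EuclideanSpace ℝ (Fin d) ≃ₗᵢ[ℝ] EuclideanSpace ℝ (Fin d) :=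
  LinearIsometry.toLinearIsometryEquiv (li :=
    { toFun := rotv o i θ
      map_add' := by
        intro x y; ext j; simp only [rotv, PiLp.add_apply]
        split_ifs <;> ring
      map_smul' := by
        intro c x; ext j; simp only [rotv, PiLp.smul_apply, smul_eq_mul, RingHom.id_apply]
        split_ifs <;> ring
      norm_map' := rotv_norm hi θ }) rfl

def rot {o i : Fin d} (hi : i ≠ o) (θ : ℝ) : Sph d → Sph d := sphMap (rotE hi θ)

lemma rot_val {i : Fin d} (hi : i ≠ o) (θ : ℝ) (x : Sph d) : (rot hi θ x).1 = rotv o i θ x.1 := rfl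

lemma rot_zero {i : Fin d} (hi : i ≠ o) (x : Sph d) : rot hi 0 x = x := by
  apply Subtype.ext
  rw [rot_val]; ext j
  simp only [rotv, cos_zero, sin_zero]
  split_ifs with h1 h2
  · subst h1; ring
  · subst h2; ring
  · rfl

lemma rot_o {i : Fin d} (hi : i ≠ o) (θ : ℝ) (x : Sph d) :
    (rot hi θ x).1 o = cos θ * x.1 o - sin θ * x.1 i := by rw [rot_val]; simp [rotv]
lemma rot_i {i : Fin d} (hi : i ≠ o) (θ : ℝ) (x : Sph d) :
    (rot hi θ x).1 i = sin θ * x.1 o + cos θ * x.1 i := by rw [rot_val]; simp [rotv, hi]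

lemma cont_rot {i : Fin d} (hi : i ≠ o) : Continuous (fun p : ℝ × Sph d => rot hi p.1 p.2) := by
  apply Continuous.subtype_mk (f := fun p : ℝ × Sph d => rotv o i p.1 p.2.1)
  unfold rotv
  apply (PiLp.continuous_toLp 2 _).comp
  apply continuous_pi
  intro j
  split_ifs <;> fun_prop

/-- derivative of the coordinates -/
lemma rot_deriv {i : Fin d} (hi : i ≠ o) (θ : ℝ) (x y : Sph d) :
    HasDerivAt (fun θ => qA lam (rot hi θ x).1 y.1)
      (lam i * (rot hi θ x).1 o * y.1 i - lam o * (rot hi θ x).1 i * y.1 o) θ := by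
  have hq : ∀ θ, qA lam (rot hi θ x).1 y.1 = lam o * (cos θ * x.1 o - sin θ * x.1 i) * y.1 o +
      (lam i * (sin θ * x.1 o + cos θ * x.1 i) * y.1 i +
      ∑ j ∈ (Finset.univ.erase o).erase i, lam j * x.1 j * y.1 j) := by
    intro θ
    unfold qA
    rw [← Finset.add_sum_erase _ _ (Finset.mem_univ o),
      ← Finset.add_sum_erase _ _ (show i ∈ Finset.univ.erase o by simp [hi]), rot_o, rot_i]
    congr 2
    apply Finset.sum_congr rfl
    intro j hj
    simp only [Finset.mem_erase] at hj
    rw [rot_val]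
    simp [rotv, hj.1, hj.2.1]
  simp only [hq, rot_o, rot_i]
  have hs := hasDerivAt_sin θ
  have hc := hasDerivAt_cos θ
  have h1 := (((hc.mul_const (x.1 o)).sub (hs.mul_const (x.1 i))).const_mul (lam o)).mul_const (y.1 o)
  have h2 := (((hs.mul_const (x.1 o)).add (hc.mul_const (x.1 i))).const_mul (lam i)).mul_const (y.1 i)
  have h3 := h1.add (h2.add_const (∑ j ∈ (Finset.univ.erase o).erase i, lam j * x.1 j * y.1 j))
  refine h3.congr_deriv ?_
  ring

lemma rot_deriv_i {i : Fin d} (hi : i ≠ o) (θ : ℝ) (x : Sph d) :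
    HasDerivAt (fun θ => (rot hi θ x).1 i) ((rot hi θ x).1 o) θ := by
  simp only [rot_o, rot_i]
  have hs := hasDerivAt_sin θ
  have hc := hasDerivAt_cos θ
  refine ((hs.mul_const (x.1 o)).add (hc.mul_const (x.1 i))).congr_deriv ?_
  ring

/-- differentiation under the integral -/
lemma deriv_int (μ : Measure (Sph d)) [IsFiniteMeasure μ] {f f' : ℝ → Sph d → ℝ}
    (hf : ∀ t, Continuous (f t)) (hf' : Continuous f'.uncurry)
    (hd : ∀ t x, HasDerivAt (fun t => f t x) (f' t x) t) (t : ℝ) :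
    HasDerivAt (fun t => ∫ x, f t x ∂μ) (∫ x, f' t x ∂μ) t := by
  obtain ⟨C, hC⟩ := ((isCompact_Icc (a := t - 1) (b := t + 1)).prod (isCompact_univ (X := Sph d))).exists_bound_of_continuousOn
    hf'.continuousOn
  refine (hasDerivAt_integral_of_dominated_loc_of_deriv_le (bound := fun _ => C)
    (s := Metric.ball t 1) (Metric.ball_mem_nhds t one_pos) ?_ (intg (hf t) μ) ?_ ?_ (integrable_const C) ?_).2
  · exact Eventually.of_forall fun t => (hf t).aestronglyMeasurable
  · exact (hf'.comp (Continuous.prodMk_right t)).aestronglyMeasurable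
  · refine ae_of_all _ fun x s hs => hC (s, x) ⟨?_, Set.mem_univ x⟩
    rw [Metric.mem_ball, Real.dist_eq, abs_lt] at hs
    exact ⟨by linarith [hs.1], by linarith [hs.2]⟩
  · exact ae_of_all _ fun x s hs => hd s x

/-- rotational derivative of W -/
def XW (lam : Fin d → ℝ) (o i : Fin d) (η : Measure (Sph d)) (x : Sph d) : ℝ :=
  ∫ y : Sph d, (lam i * x.1 o * y.1 i - lam o * x.1 i * y.1 o) * Kker lam x y ∂η

lemma cont_XW (lam : Fin d → ℝ) (o i : Fin d) (η : Measure (Sph d)) [IsFiniteMeasure η] :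
    Continuous (XW lam o i η) := by
  unfold XW
  apply cont_int (f := fun x y : Sph d => (lam i * x.1 o * y.1 i - lam o * x.1 i * y.1 o) * Kker lam x y)
  have := cont_K lam
  unfold Function.uncurry
  fun_prop

lemma rot_deriv_W {i : Fin d} (hi : i ≠ o) (η : Measure (Sph d)) [IsFiniteMeasure η] (θ : ℝ) (x : Sph d) :
    HasDerivAt (fun θ => WA lam η (rot hi θ x)) (XW lam o i η (rot hi θ x)) θ := by
  unfold WA XW
  have hcr : Continuous (fun p : ℝ × Sph d => rot hi p.1 x) :=
    (cont_rot hi).comp (continuous_fst.prodMk continuous_const)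
  apply deriv_int η (f := fun θ y => Kker lam (rot hi θ x) y)
    (f' := fun θ y => (lam i * (rot hi θ x).1 o * y.1 i - lam o * (rot hi θ x).1 i * y.1 o) * Kker lam (rot hi θ x) y)
  · intro t; exact cont_K2 lam _
  · have h1 : Continuous (fun p : ℝ × Sph d => Kker lam (rot hi p.1 x) p.2) :=
      (cont_K lam).comp (hcr.prodMk continuous_snd)
    have h2 : ∀ j, Continuous (fun p : ℝ × Sph d => (rot hi p.1 x).1 j) := fun j => (cont_co j).comp hcr
    have := h2 o
    have := h2 i
    have h3 : Continuous (fun p : ℝ × Sph d => p.2.1 o) := (cont_co o).comp continuous_snd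
    have h4 : Continuous (fun p : ℝ × Sph d => p.2.1 i) := (cont_co i).comp continuous_snd
    exact (((continuous_const.mul (h2 o)).mul h4).sub ((continuous_const.mul (h2 i)).mul h3)).mul h1
  · intro t y
    refine (rot_deriv (lam := lam) hi t x y).exp.congr_deriv ?_
    unfold Kker; ring

/-- integration by parts -/
lemma ibp (hω : IsUniform ω) {i : Fin d} (hi : i ≠ o) (η : Measure (Sph d)) [IsFiniteMeasure η]
    (hε : 0 < ε) (α β : ℝ) :
    ∫ x : Sph d, (ε * β * x.1 o + (α + β * x.1 i) * XW lam o i η x) ∂(Tm lam ω ε η) = 0 := by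
  have := hω.1
  let F : Sph d → ℝ := fun x => (α + β * x.1 i) * exp (WA lam η x / ε)
  let F' : Sph d → ℝ := fun x => exp (WA lam η x / ε) * (β * x.1 o + (α + β * x.1 i) * (XW lam o i η x / ε))
  have cW := cont_W lam η
  have cX := cont_XW lam o i η
  have hF : Continuous F := by fun_prop
  have hF' : Continuous F' := by fun_prop
  have hd := deriv_int ω (f := fun θ x => F (rot hi θ x)) (f' := fun θ x => F' (rot hi θ x))
    (fun t => hF.comp (cont_sphMap _)) (hF'.comp (cont_rot hi)) (by
      intro t x
      have h1 := ((rot_deriv_i hi t x).const_mul β).const_add α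
      have h2 := ((rot_deriv_W (lam := lam) hi η t x).div_const ε).exp
      refine (h1.mul h2).congr_deriv ?_
      simp only [F']; ring) 0
  have hconst : ∀ θ, ∫ x, F (rot hi θ x) ∂ω = ∫ x, F x ∂ω := by
    intro θ
    have h1 : ω.map (rot hi θ) = ω := hω.2 _
    conv_rhs => rw [← h1]
    have h2 : Continuous (rot hi θ) := cont_sphMap (rotE hi θ)
    rw [integral_map h2.measurable.aemeasurable hF.aestronglyMeasurable]
  simp only [hconst, rot_zero] at hd
  have h0 : ∫ x, F' x ∂ω = 0 := hd.unique (hasDerivAt_const 0 _)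
  unfold Tm
  rw [integral_tilted]
  simp only [smul_eq_mul]
  have : ∀ x : Sph d, exp (WA lam η x / ε) / (∫ x, exp (WA lam η x / ε) ∂ω) * (ε * β * x.1 o + (α + β * x.1 i) * XW lam o i η x)
      = (ε / (∫ x, exp (WA lam η x / ε) ∂ω)) * F' x := by
    intro x; simp only [F']; field_simp
  simp only [this]
  rw [integral_const_mul, h0, mul_zero]
end rot


section moments
variable {lam : Fin d → ℝ} {o : Fin d} {l2 : ℝ} {ω : Measure (Sph d)} {ε : ℝ}

lemma gap_le (h : Good lam o l2) {i : Fin d} (hi : i ≠ o) : lam i < lam o := (h.le2 i hi).trans_lt h.lt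

lemma cont_dbl (lam : Fin d → ℝ) {F : Sph d → Sph d → ℝ} (hF : Continuous F.uncurry) :
    Continuous (fun x y => F x y * Kker lam x y : Sph d → Sph d → ℝ).uncurry :=
  hF.mul (cont_K lam)

lemma dmono (μ ν : Measure (Sph d)) [IsFiniteMeasure μ] [IsFiniteMeasure ν]
    {F G : Sph d → Sph d → ℝ} (hF : Continuous F.uncurry) (hG : Continuous G.uncurry)
    (h : ∀ x y, F x y ≤ G x y) : ∫ x, ∫ y, F x y ∂ν ∂μ ≤ ∫ x, ∫ y, G x y ∂ν ∂μ := by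
  apply imono μ (cont_int hF ν) (cont_int hG ν)
  intro x
  exact imono ν (hF.comp (Continuous.prodMk_right x)) (hG.comp (Continuous.prodMk_right x)) (h x)

lemma dadd (μ ν : Measure (Sph d)) [IsFiniteMeasure μ] [IsFiniteMeasure ν]
    {F G : Sph d → Sph d → ℝ} (hF : Continuous F.uncurry) (hG : Continuous G.uncurry) :
    ∫ x, ∫ y, (F x y + G x y) ∂ν ∂μ = ∫ x, ∫ y, F x y ∂ν ∂μ + ∫ x, ∫ y, G x y ∂ν ∂μ := by
  rw [← iadd μ (cont_int hF ν) (cont_int hG ν)]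
  congr 1; ext x
  exact iadd ν (hF.comp (Continuous.prodMk_right x)) (hG.comp (Continuous.prodMk_right x))

lemma dsub (μ ν : Measure (Sph d)) [IsFiniteMeasure μ] [IsFiniteMeasure ν]
    {F G : Sph d → Sph d → ℝ} (hF : Continuous F.uncurry) (hG : Continuous G.uncurry) :
    ∫ x, ∫ y, (F x y - G x y) ∂ν ∂μ = ∫ x, ∫ y, F x y ∂ν ∂μ - ∫ x, ∫ y, G x y ∂ν ∂μ := by
  rw [← isub μ (cont_int hF ν) (cont_int hG ν)]
  congr 1; ext x
  exact isub ν (hF.comp (Continuous.prodMk_right x)) (hG.comp (Continuous.prodMk_right x))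

lemma dmulc (μ ν : Measure (Sph d)) (c : ℝ) (F : Sph d → Sph d → ℝ) :
    ∫ x, ∫ y, c * F x y ∂ν ∂μ = c * ∫ x, ∫ y, F x y ∂ν ∂μ := by
  simp only [integral_const_mul]

lemma dprod (μ ν : Measure (Sph d)) (f g : Sph d → ℝ) :
    ∫ x, ∫ y, f x * g y ∂ν ∂μ = (∫ x, f x ∂μ) * ∫ y, g y ∂ν := by
  simp only [integral_const_mul, integral_mul_const]

lemma dfst (μ ν : Measure (Sph d)) [IsProbabilityMeasure ν] (f : Sph d → ℝ) :
    ∫ x, ∫ _y : Sph d, f x ∂ν ∂μ = ∫ x, f x ∂μ := by simp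

lemma dsnd (μ ν : Measure (Sph d)) [IsProbabilityMeasure μ] (f : Sph d → ℝ) :
    ∫ _x : Sph d, ∫ y, f y ∂ν ∂μ = ∫ x, f x ∂ν := by simp

/-- rewriting ibp with u = x_i as double integral -/
lemma ibp2 (hω : IsUniform ω) {i : Fin d} (hi : i ≠ o) (η : Measure (Sph d)) [IsProbabilityMeasure η]
    (hε : 0 < ε) :
    ∫ x : Sph d, ∫ y : Sph d, (ε * x.1 o + x.1 i * ((lam i * x.1 o * y.1 i - lam o * x.1 i * y.1 o) * Kker lam x y)) ∂η ∂(Tm lam ω ε η) = 0 := by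
  have := hω.1
  have hh := ibp (lam := lam) hω hi η hε 0 1
  rw [← hh]
  congr 1; ext x
  have hc : Continuous (fun y : Sph d => x.1 i * ((lam i * x.1 o * y.1 i - lam o * x.1 i * y.1 o) * Kker lam x y)) := by
    have := cont_K2 lam x
    fun_prop
  rw [iadd η continuous_const hc]
  simp [XW, integral_const_mul]

lemma M1 (h : Good lam o l2) (hω : IsUniform ω) : ∃ C > 0, ∃ δ > 0, ∀ ε, 0 < ε → ∀ μ, IsGibbs lam ω ε μ →
    ∫ x, aa o x ∂μ ≤ δ → ∀ i, i ≠ o → ∫ x : Sph d, (x.1 i)^2 ∂μ ≤ C * ε := by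
  have hL := h.pos o
  have hgap : 0 < lam o - l2 := by linarith [h.lt]
  set g := (lam o - l2) * exp (-lam o) with hg
  have hgpos : 0 < g := mul_pos hgap (exp_pos _)
  refine ⟨2 / g, by positivity, g / (2 * Lc lam o), div_pos hgpos (by have := Lc_pos h; linarith), ?_⟩
  intro ε hε μ hG ha i hi
  have := hG.1
  have hT : Tm lam ω ε μ = μ := hG.2.symm
  have h1 := ibp2 (lam := lam) hω hi μ hε
  rw [hT] at h1
  -- pointwise
  have cK := cont_K lam
  have cx : ∀ j, Continuous (fun p : Sph d × Sph d => p.1.1 j) := fun j => (cont_co j).comp continuous_fst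
  have cy : ∀ j, Continuous (fun p : Sph d × Sph d => p.2.1 j) := fun j => (cont_co j).comp continuous_snd
  have ca : Continuous (fun p : Sph d × Sph d => aa o p.2) := (cont_aa o).comp continuous_snd
  have cxo := cx o
  have cxi := cx i
  have cyi := cy i
  have cyo := cy o
  have h2 : ∫ x : Sph d, ∫ y : Sph d, (ε * x.1 o + x.1 i * ((lam i * x.1 o * y.1 i - lam o * x.1 i * y.1 o) * Kker lam x y)) ∂μ ∂μ
     ≤ ∫ x : Sph d, ∫ y : Sph d, ((ε - lam o * ((x.1 i)^2 * Kker lam x y) + Lc lam o * ((x.1 i)^2 * aa o y)) +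
        lam i / 2 * ((x.1 i)^2 * Kker lam x y + (y.1 i)^2 * Kker lam x y)) ∂μ ∂μ := by
    apply dmono
    · unfold Function.uncurry; fun_prop
    · unfold Function.uncurry; fun_prop
    · intro x y
      have e1 : ε * x.1 o ≤ ε := by nlinarith [co_le x o]
      have k0 := K_pos lam x y
      have k1 := K_le h x y
      have e2 : x.1 i * x.1 o * y.1 i ≤ ((x.1 i)^2 + (y.1 i)^2) / 2 := by
        have b1 := co_sq_le x o
        nlinarith [sq_nonneg (x.1 i * x.1 o - y.1 i), sq_nonneg (x.1 i)]
      have e3 : lam i * (x.1 i * x.1 o * y.1 i) * Kker lam x y ≤ lam i * (((x.1 i)^2 + (y.1 i)^2) / 2) * Kker lam x y := by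
        have := (h.pos i).le
        gcongr
      have e4 : lam o * ((x.1 i)^2 * aa o y) * Kker lam x y ≤ lam o * ((x.1 i)^2 * aa o y) * exp (lam o) := by
        have := aa_nonneg o y
        gcongr
      have e5 : y.1 o = 1 - aa o y := by unfold aa; ring
      unfold Lc
      rw [e5]
      nlinarith
  rw [h1] at h2
  have hsw : ∫ x : Sph d, ∫ y : Sph d, (y.1 i)^2 * Kker lam x y ∂μ ∂μ = ∫ x : Sph d, ∫ y : Sph d, (x.1 i)^2 * Kker lam x y ∂μ ∂μ := by
    rw [dbl_swap μ μ (F := fun x y : Sph d => (y.1 i)^2 * Kker lam x y) (by unfold Function.uncurry; fun_prop)]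
    congr 1; ext x; congr 1; ext y; rw [K_symm]
  have h3 : ∫ x : Sph d, ∫ y : Sph d, ((ε - lam o * ((x.1 i)^2 * Kker lam x y) + Lc lam o * ((x.1 i)^2 * aa o y)) +
        lam i / 2 * ((x.1 i)^2 * Kker lam x y + (y.1 i)^2 * Kker lam x y)) ∂μ ∂μ
      = ε - (lam o - lam i) * (∫ x : Sph d, ∫ y : Sph d, (x.1 i)^2 * Kker lam x y ∂μ ∂μ) +
        Lc lam o * ((∫ x : Sph d, (x.1 i)^2 ∂μ) * ∫ y, aa o y ∂μ) := by
    rw [dadd μ μ (F := fun x y : Sph d => (ε - lam o * ((x.1 i)^2 * Kker lam x y) + Lc lam o * ((x.1 i)^2 * aa o y)))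
      (G := fun x y : Sph d => lam i / 2 * ((x.1 i)^2 * Kker lam x y + (y.1 i)^2 * Kker lam x y))
      (by unfold Function.uncurry; fun_prop) (by unfold Function.uncurry; fun_prop)]
    rw [dadd μ μ (F := fun x y : Sph d => ε - lam o * ((x.1 i)^2 * Kker lam x y))
      (G := fun x y : Sph d => Lc lam o * ((x.1 i)^2 * aa o y))
      (by unfold Function.uncurry; fun_prop) (by unfold Function.uncurry; fun_prop)]
    rw [dsub μ μ (F := fun x y : Sph d => ε)
      (G := fun x y : Sph d => lam o * ((x.1 i)^2 * Kker lam x y))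
      (by unfold Function.uncurry; fun_prop) (by unfold Function.uncurry; fun_prop)]
    rw [dmulc, dmulc, dmulc, dprod]
    rw [dadd μ μ (F := fun x y : Sph d => (x.1 i)^2 * Kker lam x y)
      (G := fun x y : Sph d => (y.1 i)^2 * Kker lam x y)
      (by unfold Function.uncurry; fun_prop) (by unfold Function.uncurry; fun_prop), hsw]
    simp
    ring
  rw [h3] at h2
  have h4 : exp (-lam o) * ∫ x : Sph d, (x.1 i)^2 ∂μ ≤ ∫ x : Sph d, ∫ y : Sph d, (x.1 i)^2 * Kker lam x y ∂μ ∂μ := by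
    rw [← integral_const_mul]
    have : ∫ x : Sph d, exp (-lam o) * (x.1 i)^2 ∂μ = ∫ x : Sph d, ∫ y : Sph d, exp (-lam o) * (x.1 i)^2 ∂μ ∂μ := by simp
    rw [this]
    apply dmono
    · unfold Function.uncurry; fun_prop
    · unfold Function.uncurry; fun_prop
    · intro x y
      rw [mul_comm]
      gcongr
      exact le_K h x y
  set P := ∫ x : Sph d, (x.1 i)^2 ∂μ with hP
  have hP0 : 0 ≤ P := integral_nonneg (fun x => sq_nonneg _)
  set V := ∫ x : Sph d, ∫ y : Sph d, (x.1 i)^2 * Kker lam x y ∂μ ∂μ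
  have hLc := Lc_pos h
  have h5 : Lc lam o * (P * ∫ y, aa o y ∂μ) ≤ P * (g / 2) := by
    have : Lc lam o * (P * ∫ y, aa o y ∂μ) ≤ Lc lam o * (P * (g / (2 * Lc lam o))) := by gcongr
    refine this.trans (le_of_eq ?_)
    field_simp
  have h6 : g * P ≤ (lam o - lam i) * V := by
    have a1 : lam o - l2 ≤ lam o - lam i := by linarith [h.le2 i hi]
    have a2 : 0 ≤ exp (-lam o) * P := by positivity
    calc g * P = (lam o - l2) * (exp (-lam o) * P) := by rw [hg]; ring
      _ ≤ (lam o - lam i) * V := by gcongr; linarith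
  have h7 : g / 2 * P ≤ ε := by linarith
  calc P = 2 / g * (g / 2 * P) := by field_simp
    _ ≤ 2 / g * ε := by gcongr

lemma M2 (h : Good lam o l2) (hω : IsUniform ω) (C : ℝ) (hC : 0 < C) : ∃ C' > 0, ∃ δ > 0, ∀ ε, 0 < ε → ∀ η : Measure (Sph d), IsProbabilityMeasure η →
    ∫ x, aa o x ∂η ≤ δ → ∀ i, i ≠ o → ∫ x : Sph d, (x.1 i)^2 ∂η ≤ C * ε →
      ∫ x : Sph d, (x.1 i)^2 ∂(Tm lam ω ε η) ≤ C' * ε := by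
  have hL := h.pos o
  have hLc := Lc_pos h
  set g := lam o * exp (-lam o) with hg
  have hgpos : 0 < g := mul_pos hL (exp_pos _)
  refine ⟨2 / g * (1 + Lc lam o ^ 2 * C / g), by positivity, g / (4 * Lc lam o), by positivity, ?_⟩
  intro ε hε η hη ha i hi hy2
  have := hω.1
  have hp : IsProbabilityMeasure (Tm lam ω ε η) := prob_Tm η
  have h1 := ibp2 (lam := lam) hω hi η hε
  set pm := Tm lam ω ε η with hpm
  have cK := cont_K lam
  have cx : ∀ j, Continuous (fun p : Sph d × Sph d => p.1.1 j) := fun j => (cont_co j).comp continuous_fst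
  have cy : ∀ j, Continuous (fun p : Sph d × Sph d => p.2.1 j) := fun j => (cont_co j).comp continuous_snd
  have ca : Continuous (fun p : Sph d × Sph d => aa o p.2) := (cont_aa o).comp continuous_snd
  have cxo := cx o
  have cxi := cx i
  have cyi := cy i
  have cyo := cy o
  have h2 : ∫ x : Sph d, ∫ y : Sph d, (ε * x.1 o + x.1 i * ((lam i * x.1 o * y.1 i - lam o * x.1 i * y.1 o) * Kker lam x y)) ∂η ∂pm
     ≤ ∫ x : Sph d, ∫ y : Sph d, ((ε - (g - g / 4) * ((x.1 i)^2 * 1) + Lc lam o * ((x.1 i)^2 * aa o y)) +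
        Lc lam o ^ 2 / g * (1 * (y.1 i)^2)) ∂η ∂pm := by
    apply dmono
    · unfold Function.uncurry; fun_prop
    · unfold Function.uncurry; fun_prop
    · intro x y
      have e1 : ε * x.1 o ≤ ε := by nlinarith [co_le x o]
      have k0 := K_pos lam x y
      have k1 := K_le h x y
      have k2 := le_K h x y
      have e3 : lam i * (x.1 i * x.1 o * y.1 i) * Kker lam x y ≤ Lc lam o * (|x.1 i| * |y.1 i|) := by
        have b0 := (h.pos i).le
        have b1 : x.1 i * x.1 o * y.1 i ≤ |x.1 i| * |y.1 i| := by
          refine (le_abs_self _).trans ?_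
          rw [abs_mul, abs_mul]
          gcongr
          have := co_abs_le x o
          have := abs_nonneg (x.1 i)
          nlinarith
        calc lam i * (x.1 i * x.1 o * y.1 i) * Kker lam x y ≤ lam i * (|x.1 i| * |y.1 i|) * Kker lam x y := by gcongr
          _ ≤ lam o * (|x.1 i| * |y.1 i|) * exp (lam o) := by gcongr; exact h.le i
          _ = _ := by unfold Lc; ring
      have e4 : lam o * ((x.1 i)^2 * aa o y) * Kker lam x y ≤ lam o * ((x.1 i)^2 * aa o y) * exp (lam o) := by
        have := aa_nonneg o y
        gcongr
      have e5 : y.1 o = 1 - aa o y := by unfold aa; ring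
      have e6 : lam o * (x.1 i)^2 * exp (-lam o) ≤ lam o * (x.1 i)^2 * Kker lam x y := by gcongr
      have e7 : Lc lam o * (|x.1 i| * |y.1 i|) ≤ g / 4 * (x.1 i)^2 + Lc lam o ^ 2 / g * (y.1 i)^2 := by
        have b : 0 ≤ (g / 2 * |x.1 i| - Lc lam o * |y.1 i|)^2 / g := by positivity
        have b2 : (g / 2 * |x.1 i| - Lc lam o * |y.1 i|)^2 / g
          = g / 4 * |x.1 i|^2 + Lc lam o ^ 2 / g * |y.1 i|^2 - Lc lam o * (|x.1 i| * |y.1 i|) := by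
            field_simp; ring
        rw [sq_abs, sq_abs] at b2
        linarith
      rw [e5]
      have e8 : lam o * ((x.1 i)^2 * aa o y) * exp (lam o) = Lc lam o * ((x.1 i)^2 * aa o y) := by unfold Lc; ring
      have e9 : lam o * (x.1 i)^2 * exp (-lam o) = g * (x.1 i)^2 := by rw [hg]; ring
      nlinarith
  rw [h1] at h2
  have h3 : ∫ x : Sph d, ∫ y : Sph d, ((ε - (g - g / 4) * ((x.1 i)^2 * 1) + Lc lam o * ((x.1 i)^2 * aa o y)) +
        Lc lam o ^ 2 / g * (1 * (y.1 i)^2)) ∂η ∂pm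
      = ε - (g - g / 4) * (∫ x : Sph d, (x.1 i)^2 ∂pm) +
        Lc lam o * ((∫ x : Sph d, (x.1 i)^2 ∂pm) * ∫ y, aa o y ∂η) + Lc lam o ^ 2 / g * ∫ x : Sph d, (x.1 i)^2 ∂η := by
    rw [dadd pm η (F := fun x y : Sph d => (ε - (g - g / 4) * ((x.1 i)^2 * 1) + Lc lam o * ((x.1 i)^2 * aa o y)))
      (G := fun x y : Sph d => Lc lam o ^ 2 / g * (1 * (y.1 i)^2))
      (by unfold Function.uncurry; fun_prop) (by unfold Function.uncurry; fun_prop)]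
    rw [dadd pm η (F := fun x y : Sph d => ε - (g - g / 4) * ((x.1 i)^2 * 1))
      (G := fun x y : Sph d => Lc lam o * ((x.1 i)^2 * aa o y))
      (by unfold Function.uncurry; fun_prop) (by unfold Function.uncurry; fun_prop)]
    rw [dsub pm η (F := fun x y : Sph d => ε)
      (G := fun x y : Sph d => (g - g / 4) * ((x.1 i)^2 * 1))
      (by unfold Function.uncurry; fun_prop) (by unfold Function.uncurry; fun_prop)]
    rw [dmulc, dmulc, dmulc]
    simp only [dprod]
    simp
  rw [h3] at h2
  set P := ∫ x : Sph d, (x.1 i)^2 ∂pm with hP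
  have hP0 : 0 ≤ P := integral_nonneg (fun x => sq_nonneg _)
  have h5 : Lc lam o * (P * ∫ y, aa o y ∂η) ≤ P * (g / 4) := by
    have : Lc lam o * (P * ∫ y, aa o y ∂η) ≤ Lc lam o * (P * (g / (4 * Lc lam o))) := by gcongr
    refine this.trans (le_of_eq ?_)
    field_simp
  have h6 : Lc lam o ^ 2 / g * ∫ x : Sph d, (x.1 i)^2 ∂η ≤ Lc lam o ^ 2 / g * (C * ε) := by gcongr
  have h7 : g / 2 * P ≤ ε * (1 + Lc lam o ^ 2 * C / g) := by
    have : Lc lam o ^ 2 / g * (C * ε) = ε * (Lc lam o ^ 2 * C / g) := by ring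
    linarith
  calc P = 2 / g * (g / 2 * P) := by field_simp
    _ ≤ 2 / g * (ε * (1 + Lc lam o ^ 2 * C / g)) := by gcongr
    _ = _ := by ring
end moments


section tail
variable {lam : Fin d → ℝ} {o : Fin d} {l2 : ℝ} {ω : Measure (Sph d)} {ε : ℝ}

@[fun_prop]
lemma cont_sa (o : Fin d) : Continuous (fun x : Sph d => √(aa o x)) := by fun_prop

lemma int_sqrt (μ : Measure (Sph d)) [IsProbabilityMeasure μ] {s : ℝ} (hs : 0 < s)
    (ha : ∫ x, aa o x ∂μ ≤ s ^ 2) : ∫ x, √(aa o x) ∂μ ≤ s := by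
  have h1 : ∫ x, √(aa o x) ∂μ ≤ ∫ x, ((1 / (2 * s)) * aa o x + s / 2) ∂μ := by
    apply imono μ (cont_sa o) (by fun_prop)
    intro x
    have h2 := Real.sq_sqrt (aa_nonneg o x)
    have h3 : 0 ≤ (√(aa o x) - s)^2 / (2 * s) := by positivity
    have h4 : (√(aa o x) - s)^2 / (2 * s) = (1 / (2 * s)) * √(aa o x)^2 + s / 2 - √(aa o x) := by
      field_simp; ring
    rw [h2] at h4
    linarith
  rw [iadd μ (by fun_prop) (by fun_prop), integral_const_mul] at h1
  have h5 : (1 / (2 * s)) * ∫ x, aa o x ∂μ ≤ (1 / (2 * s)) * s ^ 2 := by gcongr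
  have h6 : (1 / (2 * s)) * s ^ 2 = s / 2 := by field_simp
  simp at h1 h5 h6
  linarith

lemma K_pt (x : Sph d) : Kker lam x (pt o) = exp (lam o * x.1 o) := by
  rw [K_symm, K_pole (pt o) x 1 (by norm_num) (pt_same o), mul_one]

lemma W_near (h : Good lam o l2) (η : Measure (Sph d)) [IsProbabilityMeasure η] {s : ℝ} (hs : 0 < s)
    (ha : ∫ x, aa o x ∂η ≤ s ^ 2) (x : Sph d) : |WA lam η x - exp (lam o * x.1 o)| ≤ 2 * Lc lam o * s := by
  have h0 : WA lam η x - exp (lam o * x.1 o) = ∫ y, (Kker lam x y - Kker lam x (pt o)) ∂η := by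
    rw [isub η (cont_K2 lam x) continuous_const, K_pt]; simp [WA]
  have hL := Lc_pos h
  rw [h0]
  calc |∫ y, (Kker lam x y - Kker lam x (pt o)) ∂η| ≤ ∫ y, |Kker lam x y - Kker lam x (pt o)| ∂η :=
        abs_integral_le_integral_abs
    _ ≤ ∫ y, 2 * Lc lam o * √(aa o y) ∂η := by
        apply imono η (((cont_K2 lam x).sub continuous_const).abs) (by fun_prop)
        intro y
        refine (K_lip2 h x y (pt o)).trans ?_
        calc Lc lam o * dist y (pt o) ≤ Lc lam o * (2 * √(aa o y)) := by gcongr; exact dist_pt_le o y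
          _ = _ := by ring
    _ = 2 * Lc lam o * ∫ y, √(aa o y) ∂η := by rw [integral_const_mul]
    _ ≤ _ := by gcongr; exact int_sqrt η hs ha

lemma meas_set (o : Fin d) (r : ℝ) : MeasurableSet {x : Sph d | r ≤ aa o x} :=
  measurableSet_le measurable_const (cont_aa o).measurable

lemma tail (h : Good lam o l2) (hω : IsUniform ω) {r : ℝ} (hr : 0 < r) :
    ∃ δ > 0, ∀ κ > 0, ∃ ε0 > 0, ∀ ε, 0 < ε → ε < ε0 → ∀ η : Measure (Sph d), IsProbabilityMeasure η →
      ∫ x, aa o x ∂η ≤ δ → (Tm lam ω ε η).real {x | r ≤ aa o x} ≤ κ * ε := by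
  have := hω.1
  have hL := Lc_pos h
  have hl := h.pos o
  set g := exp (lam o * (1 - r / 2)) - exp (lam o * (1 - r)) with hg
  have hgp : 0 < g := by
    rw [hg, sub_pos, exp_lt_exp]
    nlinarith
  obtain ⟨c, hc, hb⟩ := omega_ball hω (ρ := √r) (Real.sqrt_pos.2 hr)
  set s := g / (8 * Lc lam o) with hs
  have hsp : 0 < s := by positivity
  refine ⟨s ^ 2, by positivity, fun κ hκ => ⟨κ * c * g ^ 2 / 8, by positivity, ?_⟩⟩
  intro ε hε hε2 η hη ha
  have hW := W_near h η hsp ha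
  have h4s : 2 * Lc lam o * s = g / 4 := by rw [hs]; field_simp; norm_num
  rw [h4s] at hW
  set A := exp (lam o * (1 - r)) + g / 4 with hA
  set B := exp (lam o * (1 - r / 2)) - g / 4 with hB
  have hAB : B - A = g / 2 := by rw [hA, hB, hg]; ring
  have hz := Z_lower (ω := ω) (cont_We lam ε η) (Metric.ball (pt o) (√r)) measurableSet_ball (B / ε) (by
    intro x hx
    have hx : dist x (pt o) < √r := hx
    have h1 : 2 * aa o x < r := by
      rw [← dist_sq_pt]
      calc dist x (pt o)^2 < (√r)^2 := by gcongr
        _ = r := Real.sq_sqrt hr.le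
    gcongr
    have h2 := (abs_le.1 (hW x)).1
    have h3 : exp (lam o * (1 - r / 2)) ≤ exp (lam o * x.1 o) := by
      rw [exp_le_exp]; unfold aa at h1; gcongr; linarith
    linarith)
  rw [hb] at hz
  have hZ := Zf_pos (lam := lam) (ω := ω) (ε := ε) η
  change exp (B / ε) * c ≤ Zf lam ω ε η at hz
  have h1 : (Tm lam ω ε η).real {x | r ≤ aa o x} ≤ exp (A / ε) / Zf lam ω ε η := by
    rw [← integral_indicator_one (meas_set o r)]
    unfold Tm
    rw [integral_tilted]
    have h2 : ∫ x, exp (A / ε) / Zf lam ω ε η ∂ω = exp (A / ε) / Zf lam ω ε η := by simp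
    rw [← h2]
    apply integral_mono_of_nonneg
    · refine ae_of_all _ fun x => ?_
      have : 0 ≤ ({x | r ≤ aa o x} : Set (Sph d)).indicator (1 : Sph d → ℝ) x := Set.indicator_nonneg (fun _ _ => zero_le_one) x
      have hZ' : 0 < ∫ x, exp (WA lam η x / ε) ∂ω := hZ
      simp only [smul_eq_mul, Pi.zero_apply]
      positivity
    · exact integrable_const _
    · refine ae_of_all _ fun x => ?_
      change exp (WA lam η x / ε) / Zf lam ω ε η * _ ≤ _
      by_cases hx : r ≤ aa o x
      · rw [Set.indicator_of_mem (by exact hx)]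
        simp only [Pi.one_apply, mul_one]
        gcongr
        have h2 := (abs_le.1 (hW x)).2
        have h3 : exp (lam o * x.1 o) ≤ exp (lam o * (1 - r)) := by
          rw [exp_le_exp]; unfold aa at hx; gcongr; linarith
        linarith
      · rw [Set.indicator_of_notMem (by exact hx), mul_zero]
        positivity
  refine h1.trans ?_
  calc exp (A / ε) / Zf lam ω ε η ≤ exp (A / ε) / (exp (B / ε) * c) := by gcongr
    _ = exp (-(g / (2 * ε))) / c := by
        have : -(g / (2 * ε)) = A / ε - B / ε := by
          have : g = 2 * (B - A) := by linarith
          rw [this]; field_simp; ring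
        rw [this, exp_sub]; field_simp
    _ ≤ (8 * ε ^ 2 / g ^ 2) / c := by
        gcongr
        rw [exp_neg]
        have h5 := Real.quadratic_le_exp_of_nonneg (x := g / (2 * ε)) (by positivity)
        have h6 : (g / (2 * ε)) ^ 2 / 2 ≤ exp (g / (2 * ε)) := by
          have : 0 < g / (2 * ε) := by positivity
          linarith
        calc (exp (g / (2 * ε)))⁻¹ ≤ ((g / (2 * ε)) ^ 2 / 2)⁻¹ := by gcongr
          _ = _ := by field_simp; norm_num
    _ ≤ κ * ε := by
        rw [div_div, div_le_iff₀ (by positivity)]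
        rw [lt_div_iff₀ (by norm_num)] at hε2
        nlinarith

lemma moments (h : Good lam o l2) (hω : IsUniform ω) (C : ℝ) (hC : 0 < C) :
    ∃ C1 > 0, ∀ κ > 0, ∃ δ > 0, ∃ ε0 > 0, ∀ ε, 0 < ε → ε < ε0 → ∀ η : Measure (Sph d), IsProbabilityMeasure η →
      ∫ x, aa o x ∂η ≤ δ → (∀ i, i ≠ o → ∫ x : Sph d, (x.1 i)^2 ∂η ≤ C * ε) →
      ∫ x, aa o x ∂(Tm lam ω ε η) ≤ C1 * ε ∧ ∫ x, (aa o x)^2 ∂(Tm lam ω ε η) ≤ κ ^ 2 * ε := by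
  have := hω.1
  obtain ⟨C', hC', δ1, hδ1, hM⟩ := M2 h hω C hC
  obtain ⟨δ2, hδ2, hT⟩ := tail h hω (r := 1) one_pos
  set C1 := d * C' + 2 with hC1
  have hC1p : 0 < C1 := by positivity
  refine ⟨C1, hC1p, fun κ hκ => ?_⟩
  set r := κ ^ 2 / (2 * C1) with hr
  have hrp : 0 < r := by positivity
  obtain ⟨δ3, hδ3, hT3⟩ := tail h hω (r := r) hrp
  obtain ⟨ε1, hε1, hT'⟩ := hT 1 one_pos
  obtain ⟨ε3, hε3, hT3'⟩ := hT3 (κ ^ 2 / 8) (by positivity)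
  refine ⟨min δ1 (min δ2 δ3), by positivity, min ε1 ε3, by positivity, ?_⟩
  intro ε hε hlt η hη ha hi2
  have l1 : ε < ε1 := hlt.trans_le (min_le_left _ _)
  have l3 : ε < ε3 := hlt.trans_le (min_le_right _ _)
  have a1 : ∫ x, aa o x ∂η ≤ δ1 := ha.trans (min_le_left _ _)
  have a2 : ∫ x, aa o x ∂η ≤ δ2 := ha.trans ((min_le_right _ _).trans (min_le_left _ _))
  have a3 : ∫ x, aa o x ∂η ≤ δ3 := ha.trans ((min_le_right _ _).trans (min_le_right _ _))
  have t1 := hT' ε hε l1 η hη a2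
  have t3 := hT3' ε hε l3 η hη a3
  have hp : IsProbabilityMeasure (Tm lam ω ε η) := prob_Tm η
  have hm : ∀ i, i ≠ o → ∫ x : Sph d, (x.1 i)^2 ∂(Tm lam ω ε η) ≤ C' * ε :=
    fun i hi => hM ε hε η hη a1 i hi (hi2 i hi)
  set pm := Tm lam ω ε η with hpm
  have iind : ∀ r b : ℝ, Integrable (fun x : Sph d => b * ({x | r ≤ aa o x} : Set (Sph d)).indicator (1 : Sph d → ℝ) x) pm :=
    fun r b => ((integrable_const (1:ℝ)).indicator (meas_set o r)).const_mul b
  have e1 : ∫ x, aa o x ∂pm ≤ C1 * ε := by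
    have h1 : ∫ x, aa o x ∂pm ≤ ∫ x : Sph d, ((∑ i ∈ Finset.univ.erase o, (x.1 i)^2) +
        2 * ({x | 1 ≤ aa o x} : Set (Sph d)).indicator (1 : Sph d → ℝ) x) ∂pm := by
      apply integral_mono (intg (cont_aa o) pm)
      · exact (intg (f := fun x : Sph d => ∑ i ∈ Finset.univ.erase o, (x.1 i)^2) (by fun_prop) pm).add (iind 1 2)
      · intro x
        change _ ≤ (∑ i ∈ Finset.univ.erase o, (x.1 i)^2) + 2 * ({x | 1 ≤ aa o x} : Set (Sph d)).indicator (1 : Sph d → ℝ) x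
        rw [sum_ne_sq]
        by_cases hx : 1 ≤ aa o x
        · rw [Set.indicator_of_mem (by exact hx)]
          have := aa_le o x
          have := co_sq_le x o
          simp; linarith
        · rw [Set.indicator_of_notMem (by exact hx)]
          push Not at hx
          have := co_le x o
          unfold aa at *
          nlinarith
    rw [integral_add (intg (f := fun x : Sph d => ∑ i ∈ Finset.univ.erase o, (x.1 i)^2) (by fun_prop) pm) (iind 1 2),
      integral_const_mul, integral_indicator_one (meas_set o 1),
      integral_finsetSum _ (fun i _ => intg (by fun_prop) pm)] at h1
    have h2 : ∑ i ∈ Finset.univ.erase o, ∫ x : Sph d, (x.1 i)^2 ∂pm ≤ ∑ i ∈ Finset.univ.erase o, C' * ε :=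
      Finset.sum_le_sum fun i hi => hm i (by simpa using hi)
    have h3 : ∑ i ∈ Finset.univ.erase o, C' * ε ≤ ∑ i : Fin d, C' * ε :=
      Finset.sum_le_sum_of_subset_of_nonneg (Finset.erase_subset _ _) (fun _ _ _ => by positivity)
    simp only [Finset.sum_const, Finset.card_univ, Fintype.card_fin, nsmul_eq_mul] at h3
    have h2' := h2.trans (by simpa using h3)
    rw [hC1]; linarith
  refine ⟨e1, ?_⟩
  have h1 : ∫ x, (aa o x)^2 ∂pm ≤ ∫ x : Sph d, (r * aa o x +
        4 * ({x | r ≤ aa o x} : Set (Sph d)).indicator (1 : Sph d → ℝ) x) ∂pm := by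
    apply integral_mono (intg (by fun_prop) pm)
    · exact (intg (f := fun x : Sph d => r * aa o x) (by fun_prop) pm).add (iind r 4)
    · intro x
      change _ ≤ r * aa o x + 4 * ({x | r ≤ aa o x} : Set (Sph d)).indicator (1 : Sph d → ℝ) x
      have b0 := aa_nonneg o x
      have b2 := aa_le o x
      by_cases hx : r ≤ aa o x
      · rw [Set.indicator_of_mem (by exact hx)]
        simp only [Pi.one_apply]
        nlinarith
      · rw [Set.indicator_of_notMem (by exact hx)]
        push Not at hx
        nlinarith
  rw [integral_add (intg (f := fun x : Sph d => r * aa o x) (by fun_prop) pm) (iind r 4), integral_const_mul,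
      integral_const_mul, integral_indicator_one (meas_set o r)] at h1
  have h2 : r * ∫ x, aa o x ∂pm ≤ r * (C1 * ε) := by gcongr
  have h3 : r * (C1 * ε) = κ ^ 2 / 2 * ε := by rw [hr]; field_simp
  linarith
end tail


section interp
variable {lam : Fin d → ℝ} {o : Fin d} {l2 : ℝ} {ω : Measure (Sph d)} {ε : ℝ}

lemma int_tilt {u g : Sph d → ℝ} :
    ∫ x, g x ∂(ω.tilted u) = (∫ x, g x * exp (u x) ∂ω) / ∫ x, exp (u x) ∂ω := by
  rw [integral_tilted, ← integral_div]
  congr 1; ext x; simp; ring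

lemma interp [IsProbabilityMeasure ω] {W f g : Sph d → ℝ} (hW : Continuous W) (hf : Continuous f)
    (hg : Continuous g) (hε : 0 < ε) :
    ∃ t, 0 < t ∧ t < 1 ∧
      ∫ x, g x ∂(ω.tilted (fun x => (W x + 1 * f x) / ε)) - ∫ x, g x ∂(ω.tilted (fun x => (W x + 0 * f x) / ε)) =
      1 / ε * (∫ x, g x * f x ∂(ω.tilted (fun x => (W x + t * f x) / ε))
        - (∫ x, g x ∂(ω.tilted (fun x => (W x + t * f x) / ε))) *
          ∫ x, f x ∂(ω.tilted (fun x => (W x + t * f x) / ε))) := by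
  have hZ : ∀ t : ℝ, 0 < ∫ x, exp ((W x + t * f x) / ε) ∂ω := fun t =>
    integral_exp_pos (intg (by fun_prop) ω)
  have hp : ∀ t x, HasDerivAt (fun t => (W x + t * f x) / ε) (f x / ε) t := by
    intro t x
    have := ((((hasDerivAt_id t).mul_const (f x)).const_add (W x)).div_const ε)
    refine this.congr_deriv ?_
    simp
  have d1 : ∀ t, HasDerivAt (fun t => ∫ x, g x * exp ((W x + t * f x) / ε) ∂ω)
      (∫ x, g x * (exp ((W x + t * f x) / ε) * (f x / ε)) ∂ω) t := by
    intro t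
    apply deriv_int ω (f := fun t x => g x * exp ((W x + t * f x) / ε))
      (f' := fun t x => g x * (exp ((W x + t * f x) / ε) * (f x / ε)))
    · intro t; fun_prop
    · unfold Function.uncurry; fun_prop
    · intro t x
      exact ((hp t x).exp).const_mul (g x)
  have d2 : ∀ t, HasDerivAt (fun t => ∫ x, exp ((W x + t * f x) / ε) ∂ω)
      (∫ x, (exp ((W x + t * f x) / ε) * (f x / ε)) ∂ω) t := by
    intro t
    apply deriv_int ω (f := fun t x => exp ((W x + t * f x) / ε))
      (f' := fun t x => (exp ((W x + t * f x) / ε) * (f x / ε)))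
    · intro t; fun_prop
    · unfold Function.uncurry; fun_prop
    · intro t x
      exact (hp t x).exp
  have d3 := fun t => (d1 t).fun_div (d2 t) (hZ t).ne'
  obtain ⟨t, ht, hE⟩ := exists_hasDerivAt_eq_slope _ _ (zero_lt_one' ℝ)
    (fun t _ => (d3 t).continuousAt.continuousWithinAt) (fun t _ => d3 t)
  refine ⟨t, ht.1, ht.2, ?_⟩
  simp only [int_tilt]
  rw [sub_zero, div_one] at hE
  rw [← hE]
  have i1 : ∫ x, g x * (exp ((W x + t * f x) / ε) * (f x / ε)) ∂ω = 1 / ε * ∫ x, g x * f x * exp ((W x + t * f x) / ε) ∂ω := by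
    rw [← integral_const_mul]; congr 1; ext x; field_simp
  have i2 : ∫ x, (exp ((W x + t * f x) / ε) * (f x / ε)) ∂ω = 1 / ε * ∫ x, f x * exp ((W x + t * f x) / ε) ∂ω := by
    rw [← integral_const_mul]; congr 1; ext x; field_simp
  rw [i1, i2]
  have := (hZ t).ne'
  generalize (∫ x, g x * f x * exp ((W x + t * f x) / ε) ∂ω) = a1
  generalize (∫ x, f x * exp ((W x + t * f x) / ε) ∂ω) = a2
  generalize (∫ x, g x * exp ((W x + t * f x) / ε) ∂ω) = a3
  generalize (∫ x, exp ((W x + t * f x) / ε) ∂ω) = a4 at this ⊢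
  field_simp

lemma cov_bound (P : Measure (Sph d)) [IsProbabilityMeasure P] {f g : Sph d → ℝ} (hf : Continuous f)
    (hg : Continuous g) {N α β C1 κ : ℝ} (hε : 0 < ε) (hN : 0 ≤ N) (hα : 0 ≤ α) (hβ : 0 ≤ β) (hC1 : 0 < C1)
    (hκ : 0 < κ) (bf : ∀ x, |f x - f (pt o)| ≤ N * √(aa o x))
    (bg : ∀ x, |g x - g (pt o)| ≤ α * √(aa o x) + β * aa o x)
    (m1 : ∫ x, aa o x ∂P ≤ C1 * ε) (m2 : ∫ x, (aa o x)^2 ∂P ≤ κ ^ 2 * ε) :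
    |∫ x, g x * f x ∂P - (∫ x, g x ∂P) * ∫ x, f x ∂P| ≤ ε * (N * (2 * C1 * α + β * κ * (C1 + 1))) := by
  set F : Sph d → ℝ := fun x => f x - f (pt o) with hF
  set G : Sph d → ℝ := fun x => g x - g (pt o) with hG
  have cF : Continuous F := by fun_prop
  have cG : Continuous G := by fun_prop
  have e0 : ∫ x, g x * f x ∂P - (∫ x, g x ∂P) * ∫ x, f x ∂P = ∫ x, G x * F x ∂P - (∫ x, G x ∂P) * ∫ x, F x ∂P := by
    have a1 : ∫ x, F x ∂P = ∫ x, f x ∂P - f (pt o) := by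
      rw [hF, isub P hf continuous_const]; simp
    have a2 : ∫ x, G x ∂P = ∫ x, g x ∂P - g (pt o) := by
      rw [hG, isub P hg continuous_const]; simp
    have a3 : ∫ x, G x * F x ∂P = ∫ x, g x * f x ∂P - f (pt o) * ∫ x, g x ∂P - g (pt o) * ∫ x, F x ∂P := by
      rw [← integral_const_mul, ← integral_const_mul, ← isub P (by fun_prop) (by fun_prop), ← isub P (by fun_prop) (by fun_prop)]
      congr 1; ext x; simp only [hF, hG]; ring
    rw [a3, a2, a1]; ring
  rw [e0]
  set s := √(C1 * ε) with hs
  have hsp : 0 < s := Real.sqrt_pos.2 (by positivity)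
  have hs2 : s ^ 2 = C1 * ε := Real.sq_sqrt (by positivity)
  have hq : ∫ x, √(aa o x) ∂P ≤ s := int_sqrt P hsp (by rw [hs2]; exact m1)
  have hq0 : 0 ≤ ∫ x, √(aa o x) ∂P := integral_nonneg fun x => Real.sqrt_nonneg _
  set w := κ * √ε with hw
  have hse : 0 < √ε := Real.sqrt_pos.2 hε
  have hse2 : √ε ^ 2 = ε := Real.sq_sqrt hε.le
  have hwp : 0 < w := by positivity
  have hw2 : w ^ 2 = κ ^ 2 * ε := by rw [hw, mul_pow, hse2]
  have ha0 : 0 ≤ ∫ x, aa o x ∂P := integral_nonneg fun x => aa_nonneg o x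
  have haw : ∫ x, aa o x ∂P ≤ w := by
    have h1 : ∫ x, aa o x ∂P ≤ ∫ x, (1 / (2 * w) * (aa o x)^2 + w / 2) ∂P := by
      apply imono P (cont_aa o) (by fun_prop)
      intro x
      have h3 : 0 ≤ (aa o x - w)^2 / (2 * w) := by positivity
      have h4 : (aa o x - w)^2 / (2 * w) = (1 / (2 * w)) * (aa o x)^2 + w / 2 - aa o x := by
        field_simp; ring
      linarith
    rw [iadd P (by fun_prop) (by fun_prop), integral_const_mul] at h1
    have h5 : (1 / (2 * w)) * ∫ x, (aa o x)^2 ∂P ≤ (1 / (2 * w)) * w ^ 2 := by rw [hw2]; gcongr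
    have h6 : (1 / (2 * w)) * w ^ 2 = w / 2 := by field_simp
    have h7 : ∫ x : Sph d, w / 2 ∂P = w / 2 := by simp
    rw [h7] at h1
    linarith
  -- first term
  have t1 : |∫ x, G x * F x ∂P| ≤ N * (α * (C1 * ε) + β * (κ / 2 * (C1 * ε) + κ / 2 * ε)) := by
    calc |∫ x, G x * F x ∂P| ≤ ∫ x, |G x * F x| ∂P := abs_integral_le_integral_abs
      _ ≤ ∫ x, ((N * α + N * β * (κ / 2)) * aa o x + N * β * (1 / (2 * κ)) * (aa o x)^2) ∂P := by
          apply imono P (by fun_prop) (by fun_prop)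
          intro x
          rw [abs_mul]
          have b1 := bf x
          have b2 := bg x
          have q0 := Real.sqrt_nonneg (aa o x)
          have q2 := Real.sq_sqrt (aa_nonneg o x)
          have a0 := aa_nonneg o x
          set q := √(aa o x)
          have b3 : |G x| * |F x| ≤ (α * q + β * aa o x) * (N * q) := by gcongr
          have b4 : aa o x * q ≤ κ / 2 * aa o x + 1 / (2 * κ) * (aa o x)^2 := by
            have h3 : 0 ≤ (q^2 - κ * q)^2 / (2 * κ) := by positivity
            have h4 : (q^2 - κ * q)^2 / (2 * κ) = 1 / (2 * κ) * (q^2)^2 + κ / 2 * q^2 - q^2 * q := by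
              field_simp; ring
            rw [q2] at h4 h3
            linarith
          have b5 : N * β * (aa o x * q) ≤ N * β * (κ / 2 * aa o x + 1 / (2 * κ) * (aa o x)^2) := by gcongr
          calc |G x| * |F x| ≤ (α * q + β * aa o x) * (N * q) := b3
            _ = N * α * q ^ 2 + N * β * (aa o x * q) := by ring
            _ ≤ _ := by rw [q2]; linarith
      _ = (N * α + N * β * (κ / 2)) * ∫ x, aa o x ∂P + N * β * (1 / (2 * κ)) * ∫ x, (aa o x)^2 ∂P := by
          rw [iadd P (by fun_prop) (by fun_prop), integral_const_mul, integral_const_mul]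
      _ ≤ (N * α + N * β * (κ / 2)) * (C1 * ε) + N * β * (1 / (2 * κ)) * (κ ^ 2 * ε) := by gcongr
      _ = _ := by field_simp; ring
  have t2 : |∫ x, G x ∂P| ≤ α * s + β * w := by
    calc |∫ x, G x ∂P| ≤ ∫ x, |G x| ∂P := abs_integral_le_integral_abs
      _ ≤ ∫ x, (α * √(aa o x) + β * aa o x) ∂P := imono P (by fun_prop) (by fun_prop) bg
      _ = α * ∫ x, √(aa o x) ∂P + β * ∫ x, aa o x ∂P := by
          rw [iadd P (by fun_prop) (by fun_prop), integral_const_mul, integral_const_mul]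
      _ ≤ _ := by gcongr
  have t3 : |∫ x, F x ∂P| ≤ N * s := by
    calc |∫ x, F x ∂P| ≤ ∫ x, |F x| ∂P := abs_integral_le_integral_abs
      _ ≤ ∫ x, (N * √(aa o x)) ∂P := imono P (by fun_prop) (by fun_prop) bf
      _ = N * ∫ x, √(aa o x) ∂P := by rw [integral_const_mul]
      _ ≤ _ := by gcongr
  have t4 : |(∫ x, G x ∂P) * ∫ x, F x ∂P| ≤ (α * s + β * w) * (N * s) := by
    rw [abs_mul]; gcongr
  have t5 : w * s ≤ κ * ε * ((C1 + 1) / 2) := by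
    have h1 : s = √C1 * √ε := by rw [hs, Real.sqrt_mul hC1.le]
    have h2 : √C1 ≤ (C1 + 1) / 2 := by
      have := Real.sq_sqrt hC1.le
      nlinarith [sq_nonneg (√C1 - 1)]
    calc w * s = κ * (√ε)^2 * √C1 := by rw [hw, h1]; ring
      _ ≤ _ := by rw [hse2]; gcongr
  calc |∫ x, G x * F x ∂P - (∫ x, G x ∂P) * ∫ x, F x ∂P|
      ≤ |∫ x, G x * F x ∂P| + |(∫ x, G x ∂P) * ∫ x, F x ∂P| := abs_sub _ _
    _ ≤ N * (α * (C1 * ε) + β * (κ / 2 * (C1 * ε) + κ / 2 * ε)) + (α * s + β * w) * (N * s) := add_le_add t1 t4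
    _ = N * (α * (C1 * ε) + β * (κ / 2 * (C1 * ε) + κ / 2 * ε)) + N * (α * s^2 + β * (w * s)) := by ring
    _ ≤ N * (α * (C1 * ε) + β * (κ / 2 * (C1 * ε) + κ / 2 * ε)) + N * (α * (C1 * ε) + β * (κ * ε * ((C1 + 1) / 2))) := by
        rw [hs2]; gcongr
    _ = _ := by ring

/-- mixtures -/
def mix (μ ν : Measure (Sph d)) (t : ℝ) : Measure (Sph d) :=
  ENNReal.ofReal (1 - t) • ν + ENNReal.ofReal t • μ

lemma mix_int (μ ν : Measure (Sph d)) [IsProbabilityMeasure μ] [IsProbabilityMeasure ν] {t : ℝ}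
    (h0 : 0 ≤ t) (h1 : t ≤ 1) {g : Sph d → ℝ} (hg : Continuous g) :
    ∫ x, g x ∂(mix μ ν t) = (1 - t) * ∫ x, g x ∂ν + t * ∫ x, g x ∂μ := by
  unfold mix
  rw [integral_add_measure ((intg hg ν).smul_measure ENNReal.ofReal_ne_top) ((intg hg μ).smul_measure ENNReal.ofReal_ne_top),
    integral_smul_measure, integral_smul_measure, ENNReal.toReal_ofReal (by linarith), ENNReal.toReal_ofReal h0]
  rfl

lemma mix_prob (μ ν : Measure (Sph d)) [IsProbabilityMeasure μ] [IsProbabilityMeasure ν] {t : ℝ}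
    (h0 : 0 ≤ t) (h1 : t ≤ 1) : IsProbabilityMeasure (mix μ ν t) := by
  constructor
  unfold mix
  simp
  rw [← ENNReal.ofReal_add (by linarith) h0]; simp

lemma sigma_bound [IsProbabilityMeasure ω] {μ ν : Measure (Sph d)} (hμ : IsGibbs lam ω ε μ) (hν : IsGibbs lam ω ε ν)
    {N α β C1 κ : ℝ} (hε : 0 < ε) (hN : 0 ≤ N) (hα : 0 ≤ α) (hβ : 0 ≤ β) (hC1 : 0 < C1) (hκ : 0 < κ)
    (hm : ∀ t, 0 ≤ t → t ≤ 1 → ∫ x, aa o x ∂(Tm lam ω ε (mix μ ν t)) ≤ C1 * ε ∧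
      ∫ x, (aa o x)^2 ∂(Tm lam ω ε (mix μ ν t)) ≤ κ ^ 2 * ε)
    (bf : ∀ x, |(WA lam μ x - WA lam ν x) - (WA lam μ (pt o) - WA lam ν (pt o))| ≤ N * √(aa o x))
    {g : Sph d → ℝ} (hg : Continuous g)
    (bg : ∀ x, |g x - g (pt o)| ≤ α * √(aa o x) + β * aa o x) :
    |∫ x, g x ∂μ - ∫ x, g x ∂ν| ≤ N * (2 * C1 * α + β * κ * (C1 + 1)) := by
  have := hμ.1
  have := hν.1
  have cμ := cont_W lam μ
  have cν := cont_W lam ν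
  obtain ⟨t, h0, h1, hE⟩ := interp (ω := ω) (W := WA lam ν) (f := fun x => WA lam μ x - WA lam ν x) cν (by fun_prop) hg hε
  have e1 : ω.tilted (fun x => (WA lam ν x + 1 * (WA lam μ x - WA lam ν x)) / ε) = μ := by
    have : (fun x => (WA lam ν x + 1 * (WA lam μ x - WA lam ν x)) / ε) = fun x => WA lam μ x / ε := by ext x; ring
    rw [this]; exact hμ.2.symm
  have e2 : ω.tilted (fun x => (WA lam ν x + 0 * (WA lam μ x - WA lam ν x)) / ε) = ν := by
    have : (fun x => (WA lam ν x + 0 * (WA lam μ x - WA lam ν x)) / ε) = fun x => WA lam ν x / ε := by ext x; ring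
    rw [this]; exact hν.2.symm
  have e3 : ω.tilted (fun x => (WA lam ν x + t * (WA lam μ x - WA lam ν x)) / ε) = Tm lam ω ε (mix μ ν t) := by
    unfold Tm
    congr 1; ext x
    have : WA lam (mix μ ν t) x = (1 - t) * WA lam ν x + t * WA lam μ x := mix_int μ ν h0.le h1.le (cont_K2 lam x)
    rw [this]; ring
  rw [e1, e2, e3] at hE
  have hp := mix_prob μ ν h0.le h1.le
  have hp2 : IsProbabilityMeasure (Tm lam ω ε (mix μ ν t)) := prob_Tm _
  have hc := cov_bound (Tm lam ω ε (mix μ ν t)) (f := fun x => WA lam μ x - WA lam ν x) (by fun_prop) hg hε hN hα hβ hC1 hκ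
    bf bg (hm t h0.le h1.le).1 (hm t h0.le h1.le).2
  rw [hE, abs_mul, abs_of_pos (by positivity)]
  calc 1 / ε * _ ≤ 1 / ε * (ε * (N * (2 * C1 * α + β * κ * (C1 + 1)))) := by gcongr
    _ = _ := by field_simp
end interp


section uniq
variable {lam : Fin d → ℝ} {o : Fin d} {l2 : ℝ} {ω : Measure (Sph d)} {ε : ℝ}

def CB (l : ℝ) : ℝ := 12 * l^2 * exp (2 * l) + 2 * l * exp (2 * l) * exp (2 * l)

lemma Rbound_real {l x c p b : ℝ} (hl : 0 < l) (hx : x ≤ 1) (hx' : -1 ≤ x) (hc : 0 ≤ c) (hc2 : c ≤ 2)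
    (hb : 0 ≤ b) (hb2 : b ^ 2 = 1 - x) (hp : |p| ≤ l) (hp1 : |p| ≤ 2 * l * b) (hp2 : p ^ 2 ≤ 4 * l ^ 2 * b ^ 2 * c) :
    |exp (l * x * (1 - c) + p) - exp (l * (1 - c)) - exp (l * x) + exp l - exp (l * x) * p| ≤ CB l * b * c := by
  have hb3 : b ≤ 2 := by nlinarith
  have hid : exp (l * x * (1 - c) + p) - exp (l * (1 - c)) - exp (l * x) + exp l - exp (l * x) * p =
      exp (l * x) * (exp p - 1 - p) + exp (l * x + p) * (exp (-(l * x * c)) - exp (-(l * c)))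
        + (exp (l * x + p) - exp l) * (exp (-(l * c)) - exp 0) := by
    have e1 : exp (l * x * (1 - c) + p) = exp (l * x) * exp p * exp (-(l * x * c)) := by
      rw [← exp_add, ← exp_add]; ring_nf
    have e2 : exp (l * (1 - c)) = exp l * exp (-(l * c)) := by
      rw [← exp_add]; ring_nf
    rw [e1, e2, exp_add, exp_zero]; ring
  rw [hid]
  obtain ⟨hpl, hpu⟩ := abs_le.1 hp
  have hlx : l * x ≤ l := by nlinarith
  have hlx' : -l ≤ l * x := by nlinarith
  have hlc : 0 ≤ l * c := by positivity
  have T1 : |exp (l * x) * (exp p - 1 - p)| ≤ 8 * l^2 * exp (2 * l) * b * c := by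
    have h1 : 0 ≤ exp p - 1 - p := by linarith [add_one_le_exp p]
    have h2 : exp p - 1 - p ≤ p * (exp p - 1) := by
      have := add_one_le_exp (-p)
      have h3 : exp (-p) * exp p = 1 := by rw [← exp_add]; simp
      nlinarith [exp_pos p]
    have h3 : p * (exp p - 1) ≤ exp l * p ^ 2 := by
      have := exp_lip hpu (b := 0) hl.le
      rw [exp_zero, sub_zero] at this
      calc p * (exp p - 1) ≤ |p * (exp p - 1)| := le_abs_self _
        _ = |p| * |exp p - 1| := abs_mul _ _
        _ ≤ |p| * (exp l * |p|) := by gcongr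
        _ = exp l * (|p| ^ 2) := by ring
        _ = _ := by rw [sq_abs]
    rw [abs_of_nonneg (by positivity)]
    calc exp (l * x) * (exp p - 1 - p) ≤ exp l * (exp l * (4 * l ^ 2 * b ^ 2 * c)) := by
          apply mul_le_mul (exp_le_exp.2 hlx) _ h1 (exp_pos _).le
          refine (h2.trans h3).trans ?_
          gcongr
      _ = 4 * l^2 * exp (2 * l) * (b * b) * c := by rw [two_mul l, exp_add]; ring
      _ ≤ 4 * l^2 * exp (2 * l) * (2 * b) * c := by gcongr
      _ = _ := by ring
  have hE : exp (l * x + p) ≤ exp (2 * l) := exp_le_exp.2 (by linarith)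
  have T2 : |exp (l * x + p) * (exp (-(l * x * c)) - exp (-(l * c)))| ≤ 2 * l * exp (2 * l) * exp (2 * l) * b * c := by
    rw [abs_mul, abs_of_pos (exp_pos _)]
    have h1 := exp_lip (a := -(l * x * c)) (b := -(l * c)) (M := 2 * l) (by nlinarith) (by linarith)
    have h2 : |-(l * x * c) - -(l * c)| = l * c * b ^ 2 := by
      rw [hb2, show -(l * x * c) - -(l * c) = l * c * (1 - x) by ring]
      exact abs_of_nonneg (mul_nonneg hlc (by linarith))
    rw [h2] at h1
    calc _ ≤ exp (2 * l) * (exp (2 * l) * (l * c * b ^ 2)) := by gcongr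
      _ = l * exp (2 * l) * exp (2 * l) * (b * b) * c := by ring
      _ ≤ l * exp (2 * l) * exp (2 * l) * (2 * b) * c := by gcongr
      _ = _ := by ring
  have T3 : |(exp (l * x + p) - exp l) * (exp (-(l * c)) - exp 0)| ≤ 4 * l^2 * exp (2 * l) * b * c := by
    rw [abs_mul]
    have h1 := exp_lip (a := l * x + p) (b := l) (M := 2 * l) (by linarith) (by linarith)
    have h2 : |l * x + p - l| ≤ 4 * l * b := by
      calc |l * x + p - l| = |p + -(l * b ^ 2)| := by rw [hb2]; ring_nf
        _ ≤ |p| + |-(l * b ^ 2)| := abs_add_le _ _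
        _ = |p| + l * (b * b) := by rw [abs_neg, abs_of_nonneg (a := l * b ^ 2) (by positivity)]; ring
        _ ≤ 2 * l * b + l * (2 * b) := by gcongr
        _ = _ := by ring
    have h3 := exp_lip (a := -(l * c)) (b := 0) (M := 0) (by linarith) le_rfl
    rw [sub_zero, abs_neg, abs_of_nonneg hlc] at h3
    calc _ ≤ (exp (2 * l) * (4 * l * b)) * (exp 0 * (l * c)) := by gcongr; exact h1.trans (by gcongr)
      _ = _ := by rw [exp_zero]; ring
  refine (abs_add_three _ _ _).trans ?_
  unfold CB
  linarith

lemma Rbound (h : Good lam o l2) (x y : Sph d) :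
    |Kker lam x y - Kker lam (pt o) y - exp (lam o * x.1 o) * ∑ i ∈ Finset.univ.erase o, lam i * x.1 i * y.1 i
      - (Kker lam x (pt o) - Kker lam (pt o) (pt o))| ≤ CB (lam o) * √(aa o x) * aa o y := by
  have hl := h.pos o
  set p := ∑ i ∈ Finset.univ.erase o, lam i * x.1 i * y.1 i with hp
  have k1 : Kker lam x y = exp (lam o * x.1 o * (1 - aa o y) + p) := by
    unfold Kker qA
    rw [← Finset.add_sum_erase _ _ (Finset.mem_univ o)]
    simp [aa, hp]
  have k2 : Kker lam (pt o) y = exp (lam o * (1 - aa o y)) := by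
    rw [K_symm, K_pt]; simp [aa]
  have k3 : Kker lam x (pt o) = exp (lam o * x.1 o) := K_pt x
  have k4 : Kker lam (pt o) (pt o) = exp (lam o) := by rw [K_pt, pt_same, mul_one]
  have sx : ∀ z : Sph d, ∑ i ∈ Finset.univ.erase o, (z.1 i)^2 ≤ 2 * aa o z := by
    intro z; rw [sum_ne_sq]; unfold aa; nlinarith [sq_nonneg (1 - z.1 o)]
  have sx1 : ∀ z : Sph d, ∑ i ∈ Finset.univ.erase o, (z.1 i)^2 ≤ 1 := by
    intro z; rw [sum_ne_sq]; nlinarith [sq_nonneg (z.1 o)]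
  have sx0 : ∀ z : Sph d, 0 ≤ ∑ i ∈ Finset.univ.erase o, (z.1 i)^2 := by
    intro z; positivity
  have pc : p ^ 2 ≤ lam o ^ 2 * (∑ i ∈ Finset.univ.erase o, (x.1 i)^2) * ∑ i ∈ Finset.univ.erase o, (y.1 i)^2 := by
    refine (Finset.sum_mul_sq_le_sq_mul_sq _ (fun i => lam i * x.1 i) (fun i => y.1 i)).trans ?_
    gcongr ?_ * _
    rw [Finset.mul_sum]
    apply Finset.sum_le_sum
    intro i _
    rw [mul_pow]
    have := h.pos i
    have := h.le i
    gcongr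
  have hb2 := Real.sq_sqrt (aa_nonneg o x)
  have hb := Real.sqrt_nonneg (aa o x)
  have pl : |p| ≤ lam o := by
    apply abs_le_of_sq_le_sq _ hl.le
    calc p ^ 2 ≤ _ := pc
      _ ≤ lam o ^ 2 * 1 * 1 := by gcongr; exacts [sx1 x, sx1 y]
      _ = _ := by ring
  have p1 : |p| ≤ 2 * lam o * √(aa o x) := by
    apply abs_le_of_sq_le_sq _ (by positivity)
    calc p ^ 2 ≤ _ := pc
      _ ≤ lam o ^ 2 * (2 * aa o x) * 1 := by
        have := aa_nonneg o x
        gcongr; exacts [sx x, sx1 y]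
      _ ≤ _ := by rw [mul_pow, hb2]; nlinarith [mul_nonneg (sq_nonneg (lam o)) (aa_nonneg o x)]
  have p2 : p ^ 2 ≤ 4 * lam o ^ 2 * √(aa o x) ^ 2 * aa o y := by
    calc p ^ 2 ≤ _ := pc
      _ ≤ lam o ^ 2 * (2 * aa o x) * (2 * aa o y) := by
        have := aa_nonneg o x
        gcongr; exacts [sx x, sx y]
      _ = _ := by rw [hb2]; ring
  have := Rbound_real hl (co_le x o) (neg_le_co x o) (aa_nonneg o y) (aa_le o y) hb (by rw [hb2]; rfl) pl p1 p2
  rw [k1, k2, k3, k4]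
  refine le_trans (le_of_eq ?_) this
  congr 1; ring

lemma sym0 (h : Good lam o l2) (hω : IsUniform ω) (hε : 0 < ε) {μ : Measure (Sph d)} (hμ : IsGibbs lam ω ε μ)
    {i : Fin d} (hi : i ≠ o) : ∫ x : Sph d, ∫ y : Sph d, x.1 i * y.1 o * Kker lam x y ∂μ ∂μ = 0 := by
  have := hμ.1
  have cK := cont_K lam
  have h1 := ibp (lam := lam) hω hi μ hε 1 0
  rw [← (gibbs_iff.1 hμ).2] at h1
  have h2 : ∫ x : Sph d, ∫ y : Sph d, (lam i * (x.1 o * y.1 i * Kker lam x y) - lam o * (x.1 i * y.1 o * Kker lam x y)) ∂μ ∂μ = 0 := by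
    rw [← h1]; congr 1; ext x
    simp only [XW, mul_zero, zero_mul, zero_add, add_zero, one_mul]
    congr 1; ext y; ring
  rw [dsub μ μ (F := fun x y => lam i * (x.1 o * y.1 i * Kker lam x y)) (G := fun x y => lam o * (x.1 i * y.1 o * Kker lam x y))
    (by unfold Function.uncurry; fun_prop) (by unfold Function.uncurry; fun_prop), dmulc, dmulc] at h2
  have h3 : ∫ x : Sph d, ∫ y : Sph d, x.1 o * y.1 i * Kker lam x y ∂μ ∂μ = ∫ x : Sph d, ∫ y : Sph d, x.1 i * y.1 o * Kker lam x y ∂μ ∂μ := by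
    rw [dbl_swap μ μ (F := fun x y => x.1 o * y.1 i * Kker lam x y) (by unfold Function.uncurry; fun_prop)]
    congr 1; ext x; congr 1; ext y
    rw [K_symm]; ring
  rw [h3] at h2
  have h4 := h.le2 i hi
  have h5 := h.lt
  have h6 : (lam i - lam o) * ∫ x : Sph d, ∫ y : Sph d, x.1 i * y.1 o * Kker lam x y ∂μ ∂μ = 0 := by linarith
  rcases mul_eq_zero.1 h6 with h7 | h7
  · linarith
  · exact h7

lemma coordA (h : Good lam o l2) (hω : IsUniform ω) {μ ν : Measure (Sph d)} (hμ : IsGibbs lam ω ε μ) (hν : IsGibbs lam ω ε ν)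
    {N C1 κ : ℝ} (hε : 0 < ε) (hN : 0 ≤ N) (hC1 : 0 < C1) (hκ : 0 < κ) (hκ1 : κ ≤ 1)
    (aμ : ∫ x, aa o x ∂μ ≤ κ ^ 2) (aν : ∫ x, aa o x ∂ν ≤ κ ^ 2)
    (hm : ∀ t, 0 ≤ t → t ≤ 1 → ∫ x, aa o x ∂(Tm lam ω ε (mix μ ν t)) ≤ C1 * ε ∧
      ∫ x, (aa o x)^2 ∂(Tm lam ω ε (mix μ ν t)) ≤ κ ^ 2 * ε)
    (bf : ∀ x, |(WA lam μ x - WA lam ν x) - (WA lam μ (pt o) - WA lam ν (pt o))| ≤ N * √(aa o x))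
    {i : Fin d} (hi : i ≠ o) :
    exp (lam o) * |∫ x : Sph d, x.1 i ∂μ - ∫ x : Sph d, x.1 i ∂ν| ≤
      N * κ * (2 * C1 * (8 * Lc lam o + 2 * exp (lam o)) + (exp (lam o) + Lc lam o) * (C1 + 1)) := by
  have := hω.1
  have := hμ.1
  have := hν.1
  have hL := Lc_pos h
  have cK := cont_K lam
  set E := exp (lam o) with hE
  have hEp : 0 < E := exp_pos _
  let T : Sph d → ℝ := fun z => ∫ x : Sph d, x.1 i * Kker lam x z ∂μ
  let V : Sph d → ℝ := fun z => ∫ y : Sph d, y.1 o * Kker lam z y ∂ν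
  have cT : Continuous T := cont_int (f := fun z x : Sph d => x.1 i * Kker lam x z) (by
    have : Continuous (fun p : Sph d × Sph d => Kker lam p.2 p.1) := cK.comp continuous_swap
    unfold Function.uncurry; fun_prop) μ
  have cV : Continuous V := cont_int (f := fun z y : Sph d => y.1 o * Kker lam z y) (by
    unfold Function.uncurry; fun_prop) ν
  have c0 : Continuous (Function.uncurry (fun x y : Sph d => x.1 i * y.1 o * Kker lam x y)) := by
    unfold Function.uncurry; fun_prop
  have d1 : ∀ η : Measure (Sph d), IsProbabilityMeasure η →
      ∫ x : Sph d, ∫ y : Sph d, x.1 i * y.1 o * Kker lam x y ∂η ∂μ = ∫ z : Sph d, z.1 o * T z ∂η := by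
    intro η hη
    rw [dbl_swap μ η c0]
    congr 1; ext z
    simp only [T]
    rw [← integral_const_mul]
    congr 1; ext x; ring
  have d2 : ∀ η : Measure (Sph d), 
      ∫ x : Sph d, ∫ y : Sph d, x.1 i * y.1 o * Kker lam x y ∂ν ∂η = ∫ z : Sph d, z.1 i * V z ∂η := by
    intro η
    congr 1; ext z
    simp only [V]
    rw [← integral_const_mul]
    congr 1; ext x; ring
  have z1 := sym0 h hω hε hμ hi
  have z2 := sym0 h hω hε hν hi
  rw [d1 μ inferInstance] at z1
  rw [d2] at z2
  have z3 : ∫ z : Sph d, z.1 o * T z ∂ν = ∫ z : Sph d, z.1 i * V z ∂μ := by rw [← d1 ν inferInstance, d2]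
  let r : Sph d → ℝ := fun z => z.1 o * T z + z.1 i * V z - E * z.1 i
  have cr : Continuous r := by fun_prop
  have ri : ∀ η : Measure (Sph d), IsProbabilityMeasure η → ∫ z, r z ∂η = ∫ z : Sph d, z.1 o * T z ∂η + ∫ z : Sph d, z.1 i * V z ∂η - E * ∫ z : Sph d, z.1 i ∂η := by
    intro η hη
    simp only [r]
    rw [isub η (by fun_prop) (by fun_prop), iadd η (by fun_prop) (by fun_prop), integral_const_mul]
  have key : ∫ z, r z ∂μ - ∫ z, r z ∂ν = -(E * (∫ x : Sph d, x.1 i ∂μ - ∫ x : Sph d, x.1 i ∂ν)) := by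
    rw [ri μ inferInstance, ri ν inferInstance, z1, z2, z3]; ring
  have sq := int_sqrt μ hκ aμ
  have bT : ∀ z, |T z - T (pt o)| ≤ 4 * Lc lam o * κ * √(aa o z) := by
    intro z
    have q0 := Real.sqrt_nonneg (aa o z)
    have cz := cont_K1 lam z
    have cp := cont_K1 lam (pt o)
    have e1 : T z - T (pt o) = ∫ x : Sph d, (x.1 i * Kker lam x z - x.1 i * Kker lam x (pt o)) ∂μ := by
      rw [isub μ (by fun_prop) (by fun_prop)]
    rw [e1]
    calc _ ≤ ∫ x : Sph d, |x.1 i * Kker lam x z - x.1 i * Kker lam x (pt o)| ∂μ := abs_integral_le_integral_abs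
      _ ≤ ∫ x : Sph d, (4 * Lc lam o * √(aa o z)) * √(aa o x) ∂μ := by
        apply imono μ (by fun_prop) (continuous_const.mul (cont_sa o))
        intro x
        rw [← mul_sub, abs_mul]
        have b1 := co_abs_le_aa hi x
        have b2 := (K_lip2 h x z (pt o)).trans (mul_le_mul_of_nonneg_left (dist_pt_le o z) hL.le)
        calc _ ≤ (2 * √(aa o x)) * (Lc lam o * (2 * √(aa o z))) := by gcongr
          _ = 4 * Lc lam o * √(aa o z) * √(aa o x) := by ring
      _ = (4 * Lc lam o * √(aa o z)) * ∫ x : Sph d, √(aa o x) ∂μ := integral_const_mul _ _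
      _ ≤ (4 * Lc lam o * √(aa o z)) * κ := by gcongr
      _ = _ := by ring
  have bT0 : |T (pt o)| ≤ E := by
    have cp := cont_K1 lam (pt o)
    calc |T (pt o)| ≤ ∫ x : Sph d, |x.1 i * Kker lam x (pt o)| ∂μ := abs_integral_le_integral_abs
      _ ≤ ∫ x : Sph d, E ∂μ := by
        apply imono μ (by fun_prop) continuous_const
        intro x
        rw [abs_mul, abs_of_pos (K_pos _ _ _)]
        calc _ ≤ 1 * E := by
              have := (K_pos lam x (pt o)).le
              gcongr; exacts [co_abs_le x i, K_le h _ _]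
          _ = E := one_mul E
      _ = E := by simp
  have bV : ∀ z, |V z - E| ≤ E * κ + 2 * Lc lam o * κ + Lc lam o * aa o z := by
    intro z
    have cz := cont_K2 lam z
    have e1 : V z - WA lam ν z = -∫ y : Sph d, aa o y * Kker lam z y ∂ν := by
      simp only [V, WA]
      rw [← isub ν (by fun_prop) (by fun_prop), ← integral_neg]
      congr 1; ext y; unfold aa; ring
    have e2 : |V z - WA lam ν z| ≤ E * κ := by
      rw [e1, abs_neg, abs_of_nonneg (integral_nonneg fun y => mul_nonneg (aa_nonneg o y) (K_pos _ _ _).le)]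
      calc _ ≤ ∫ y : Sph d, E * aa o y ∂ν := by
            apply imono ν (by fun_prop) (by fun_prop)
            intro y
            have := mul_le_mul_of_nonneg_left (K_le h z y) (aa_nonneg o y)
            linarith
        _ = E * ∫ y : Sph d, aa o y ∂ν := integral_const_mul _ _
        _ ≤ E * κ := by
            gcongr
            nlinarith
    have e3 := W_near h ν hκ aν z
    have e4 : |exp (lam o * z.1 o) - E| ≤ Lc lam o * aa o z := by
      have hl := h.pos o
      have := exp_lip (a := lam o * z.1 o) (b := lam o) (M := lam o) (by nlinarith [co_le z o]) le_rfl
      rw [show lam o * z.1 o - lam o = -(lam o * aa o z) by unfold aa; ring, abs_neg, abs_of_nonneg (mul_nonneg hl.le (aa_nonneg o z))] at this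
      unfold Lc
      rw [mul_assoc]; exact this
    have e5 : V z - E = (V z - WA lam ν z) + (WA lam ν z - exp (lam o * z.1 o)) + (exp (lam o * z.1 o) - E) := by ring
    rw [e5]
    refine (abs_add_three _ _ _).trans ?_
    linarith
  have br : ∀ z, |r z - r (pt o)| ≤ ((8 * Lc lam o + 2 * E) * κ) * √(aa o z) + (E + Lc lam o) * aa o z := by
    intro z
    have q0 := Real.sqrt_nonneg (aa o z)
    have a0 := aa_nonneg o z
    have e1 : r z - r (pt o) = z.1 o * (T z - T (pt o)) + (-(aa o z * T (pt o))) + z.1 i * (V z - E) := by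
      simp only [r, pt_same, pt_ne hi]; unfold aa; ring
    rw [e1]
    refine (abs_add_three _ _ _).trans ?_
    rw [abs_neg, abs_mul, abs_mul, abs_mul, abs_of_nonneg a0]
    have f1 : |z.1 o| * |T z - T (pt o)| ≤ 1 * (4 * Lc lam o * κ * √(aa o z)) := by
      gcongr; exacts [co_abs_le z o, bT z]
    have f2 : aa o z * |T (pt o)| ≤ aa o z * E := by gcongr
    have f3 : |z.1 i| * |V z - E| ≤ 2 * √(aa o z) * (E * κ + 2 * Lc lam o * κ) + 1 * (Lc lam o * aa o z) := by
      calc _ ≤ |z.1 i| * (E * κ + 2 * Lc lam o * κ + Lc lam o * aa o z) := by gcongr; exact bV z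
        _ = |z.1 i| * (E * κ + 2 * Lc lam o * κ) + |z.1 i| * (Lc lam o * aa o z) := by ring
        _ ≤ _ := by gcongr; exacts [co_abs_le_aa hi z, co_abs_le z i]
    linarith
  have fin := sigma_bound hμ hν hε hN (by positivity) (by positivity) hC1 hκ hm bf cr br
  rw [key, abs_neg, abs_mul, abs_of_pos hEp] at fin
  refine fin.trans (le_of_eq ?_)
  ring

def CC (lam : Fin d → ℝ) (o : Fin d) (C1 : ℝ) : ℝ :=
  CB (lam o) * (C1 + 1) + 2 * d * lam o * (2 * C1 * (8 * Lc lam o + 2 * exp (lam o)) + (exp (lam o) + Lc lam o) * (C1 + 1))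

lemma CB_pos {l : ℝ} (hl : 0 < l) : 0 < CB l := by unfold CB; positivity

lemma contract (h : Good lam o l2) (hω : IsUniform ω) {μ ν : Measure (Sph d)} (hμ : IsGibbs lam ω ε μ) (hν : IsGibbs lam ω ε ν)
    {N C1 κ : ℝ} (hε : 0 < ε) (hN : 0 ≤ N) (hC1 : 0 < C1) (hκ : 0 < κ) (hκ1 : κ ≤ 1)
    (aμ : ∫ x, aa o x ∂μ ≤ κ ^ 2) (aν : ∫ x, aa o x ∂ν ≤ κ ^ 2)
    (hm : ∀ t, 0 ≤ t → t ≤ 1 → ∫ x, aa o x ∂(Tm lam ω ε (mix μ ν t)) ≤ C1 * ε ∧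
      ∫ x, (aa o x)^2 ∂(Tm lam ω ε (mix μ ν t)) ≤ κ ^ 2 * ε)
    (bf : ∀ x, |(WA lam μ x - WA lam ν x) - (WA lam μ (pt o) - WA lam ν (pt o))| ≤ N * √(aa o x)) (x : Sph d) :
    |(WA lam μ x - WA lam ν x) - (WA lam μ (pt o) - WA lam ν (pt o))| ≤ (N * (κ * CC lam o C1)) * √(aa o x) := by
  have := hω.1
  have := hμ.1
  have := hν.1
  have hl := h.pos o
  have hB := CB_pos hl
  have q0 := Real.sqrt_nonneg (aa o x)
  have cx := cont_K2 lam x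
  have cp := cont_K2 lam (pt o)
  set e := exp (lam o * x.1 o) with he
  have he0 : 0 < e := exp_pos _
  have heE : e ≤ exp (lam o) := exp_le_exp.2 (by nlinarith [co_le x o])
  let g : Sph d → ℝ := fun y => Kker lam x y - Kker lam (pt o) y - e * ∑ i ∈ Finset.univ.erase o, lam i * x.1 i * y.1 i
  have cs : Continuous (fun y : Sph d => ∑ i ∈ Finset.univ.erase o, lam i * x.1 i * y.1 i) := by fun_prop
  have cg : Continuous g := by fun_prop
  have gi : ∀ η : Measure (Sph d), IsProbabilityMeasure η → ∫ y, g y ∂η = WA lam η x - WA lam η (pt o) -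
      e * ∑ i ∈ Finset.univ.erase o, lam i * x.1 i * ∫ y : Sph d, y.1 i ∂η := by
    intro η hη
    simp only [g]
    rw [isub η (by fun_prop) (by fun_prop), isub η (by fun_prop) (by fun_prop), integral_const_mul,
      integral_finsetSum _ (fun i _ => intg (by fun_prop) η)]
    simp only [integral_const_mul, WA]
  have gp : g (pt o) = Kker lam x (pt o) - Kker lam (pt o) (pt o) := by
    simp only [g]
    rw [Finset.sum_eq_zero]
    · ring
    · intro i hi
      rw [pt_ne (Finset.ne_of_mem_erase hi)]; ring
  have bg : ∀ y, |g y - g (pt o)| ≤ 0 * √(aa o y) + (CB (lam o) * √(aa o x)) * aa o y := by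
    intro y
    rw [gp, zero_mul, zero_add]
    exact Rbound h x y
  have s1 := sigma_bound hμ hν hε hN le_rfl (by positivity) hC1 hκ hm bf cg bg
  set CA := 2 * C1 * (8 * Lc lam o + 2 * exp (lam o)) + (exp (lam o) + Lc lam o) * (C1 + 1) with hCA
  have hL := Lc_pos h
  have hCA0 : 0 < CA := by positivity
  have s2 : |e * ∑ i ∈ Finset.univ.erase o, lam i * x.1 i * (∫ y : Sph d, y.1 i ∂μ - ∫ y : Sph d, y.1 i ∂ν)| ≤
      d * (lam o * (2 * √(aa o x)) * (N * κ * CA)) := by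
    rw [Finset.mul_sum]
    calc _ ≤ ∑ i ∈ Finset.univ.erase o, |e * (lam i * x.1 i * (∫ y : Sph d, y.1 i ∂μ - ∫ y : Sph d, y.1 i ∂ν))| :=
          Finset.abs_sum_le_sum_abs _ _
      _ ≤ ∑ i ∈ Finset.univ.erase o, (lam o * (2 * √(aa o x)) * (N * κ * CA)) := by
          apply Finset.sum_le_sum
          intro i hi
          have hi := Finset.ne_of_mem_erase hi
          have b1 := coordA h hω hμ hν hε hN hC1 hκ hκ1 aμ aν hm bf hi
          have b2 := co_abs_le_aa hi x
          rw [abs_mul, abs_mul, abs_mul, abs_of_pos he0, abs_of_pos (h.pos i)]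
          have b3 : e * |∫ y : Sph d, y.1 i ∂μ - ∫ y : Sph d, y.1 i ∂ν| ≤ N * κ * CA :=
            le_trans (by gcongr) b1
          calc _ = lam i * |x.1 i| * (e * |∫ y : Sph d, y.1 i ∂μ - ∫ y : Sph d, y.1 i ∂ν|) := by ring
            _ ≤ _ := by gcongr; exact h.le i
      _ = ((Finset.univ.erase o).card : ℝ) * (lam o * (2 * √(aa o x)) * (N * κ * CA)) := by
          rw [Finset.sum_const, nsmul_eq_mul]
      _ ≤ _ := by
          gcongr
          refine (Finset.card_le_univ _).trans ?_
          simp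
  have s3 : (WA lam μ x - WA lam ν x) - (WA lam μ (pt o) - WA lam ν (pt o)) = (∫ y, g y ∂μ - ∫ y, g y ∂ν) +
      e * ∑ i ∈ Finset.univ.erase o, lam i * x.1 i * (∫ y : Sph d, y.1 i ∂μ - ∫ y : Sph d, y.1 i ∂ν) := by
    rw [gi μ inferInstance, gi ν inferInstance]
    simp only [mul_sub, Finset.sum_sub_distrib]
    ring
  rw [s3]
  refine (abs_add_le _ _).trans ((add_le_add s1 s2).trans (le_of_eq ?_))
  unfold CC
  rw [← hCA]; ring

theorem uniq (h : Good lam o l2) (hω : IsUniform ω) : ∃ δ > 0, ∃ ε0 > 0, ∀ ε, 0 < ε → ε < ε0 → ∀ μ ν : Measure (Sph d),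
    IsGibbs lam ω ε μ → IsGibbs lam ω ε ν → ∫ x, aa o x ∂μ ≤ δ → ∫ x, aa o x ∂ν ≤ δ → μ = ν := by
  have := hω.1
  obtain ⟨C, hC, δ1, hδ1, hM⟩ := M1 h hω
  obtain ⟨C1, hC1, hmom⟩ := moments h hω C hC
  have hl := h.pos o
  have hL := Lc_pos h
  have hB := CB_pos hl
  have hCC : 0 < CC lam o C1 := by unfold CC; positivity
  set κ := min 1 (1 / (2 * CC lam o C1)) with hκd
  have hκ : 0 < κ := lt_min one_pos (by positivity)
  have hκ1 : κ ≤ 1 := min_le_left _ _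
  have hκ2 : κ * CC lam o C1 ≤ 1 / 2 := by
    have : κ ≤ 1 / (2 * CC lam o C1) := min_le_right _ _
    calc _ ≤ 1 / (2 * CC lam o C1) * CC lam o C1 := by gcongr
      _ = _ := by field_simp
  obtain ⟨δ2, hδ2, ε0, hε0, hmo⟩ := hmom κ hκ
  refine ⟨min (κ^2) (min δ1 δ2), lt_min (by positivity) (lt_min hδ1 hδ2), ε0, hε0, ?_⟩
  intro ε hε hεε μ ν hμ hν aμ aν
  have := hμ.1
  have := hν.1
  have aμ1 := aμ.trans (min_le_left _ _)
  have aν1 := aν.trans (min_le_left _ _)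
  have aμ2 := aμ.trans ((min_le_right _ _).trans (min_le_left _ _))
  have aν2 := aν.trans ((min_le_right _ _).trans (min_le_left _ _))
  have aμ3 := aμ.trans ((min_le_right _ _).trans (min_le_right _ _))
  have aν3 := aν.trans ((min_le_right _ _).trans (min_le_right _ _))
  have hm : ∀ t, 0 ≤ t → t ≤ 1 → ∫ x, aa o x ∂(Tm lam ω ε (mix μ ν t)) ≤ C1 * ε ∧
      ∫ x, (aa o x)^2 ∂(Tm lam ω ε (mix μ ν t)) ≤ κ ^ 2 * ε := by
    intro t h0 h1
    have h1' : 0 ≤ 1 - t := by linarith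
    apply hmo ε hε hεε _ (mix_prob μ ν h0 h1)
    · rw [mix_int μ ν h0 h1 (cont_aa o)]
      nlinarith
    · intro i hi
      rw [mix_int μ ν h0 h1 (by fun_prop)]
      have b1 := hM ε hε μ hμ aμ2 i hi
      have b2 := hM ε hε ν hν aν2 i hi
      nlinarith
  have it : ∀ n : ℕ, ∀ x, |(WA lam μ x - WA lam ν x) - (WA lam μ (pt o) - WA lam ν (pt o))| ≤
      (4 * Lc lam o * (1 / 2) ^ n) * √(aa o x) := by
    intro n
    induction n with
    | zero =>
      intro x
      have b1 := W_lip h μ x (pt o)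
      have b2 := W_lip h ν x (pt o)
      have b3 := mul_le_mul_of_nonneg_left (dist_pt_le o x) hL.le
      rw [abs_le] at b1 b2 ⊢
      constructor <;> simp only [pow_zero, mul_one] <;> linarith [b1.1, b1.2, b2.1, b2.2]
    | succ n ih =>
      intro x
      refine (contract h hω hμ hν hε (by positivity) hC1 hκ hκ1 aμ1 aν1 hm ih x).trans ?_
      rw [pow_succ, ← mul_assoc (4 * Lc lam o) _ (1 / 2)]
      apply mul_le_mul_of_nonneg_right _ (Real.sqrt_nonneg _)
      exact mul_le_mul_of_nonneg_left hκ2 (by positivity)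
  have z : ∀ x, WA lam μ x - WA lam ν x = WA lam μ (pt o) - WA lam ν (pt o) := by
    intro x
    have lim : Tendsto (fun n : ℕ => (4 * Lc lam o * (1 / 2 : ℝ) ^ n) * √(aa o x)) atTop (𝓝 ((4 * Lc lam o * 0) * √(aa o x))) := by
      refine Tendsto.mul_const _ (Tendsto.const_mul _ ?_)
      exact tendsto_pow_atTop_nhds_zero_of_lt_one (by norm_num) (by norm_num)
    have := ge_of_tendsto' lim (fun n => it n x)
    rw [mul_zero, zero_mul] at this
    have := abs_nonpos_iff.1 this
    linarith
  set c := WA lam μ (pt o) - WA lam ν (pt o)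
  rw [hμ.2, hν.2]
  congr 1; ext x
  congr 1
  have e1 : ∀ x, exp (WA lam μ x / ε) = exp (c / ε) * exp (WA lam ν x / ε) := by
    intro x
    rw [← exp_add, ← z x]; ring_nf
  simp only [e1]
  rw [integral_const_mul, mul_div_mul_left _ _ (exp_pos _).ne']
end uniq


section final
variable {lam : Fin d → ℝ} {o : Fin d} {l2 : ℝ} {ω : Measure (Sph d)} {ε : ℝ}

theorem main_gap (h : Good lam o l2) (hω : IsUniform ω) {γ : ℝ} (hγ : 0 < γ) :
    ∃ εγ : ℝ, 0 < εγ ∧ ∀ ε : ℝ, 0 < ε → ε < εγ →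
      ∀ μ : Measure (Sph d), IsGibbs lam ω ε μ → ¬ IsMinimizer lam ω ε μ →
        (((exp (lam o) - max (exp l2) (cosh (lam o))) / 2 - γ : ℝ) : EReal) ≤ EA lam ω ε μ - mEps lam ω ε := by
  have := hω.1
  set E := exp (lam o) with hE
  set Q := max (exp l2) (cosh (lam o)) with hQ
  have hQE : Q < E := by
    apply max_lt (exp_lt_exp.2 h.lt)
    rw [cosh_eq]
    have : exp (-lam o) < exp (lam o) := exp_lt_exp.2 (by linarith [h.pos o])
    linarith
  obtain ⟨δ, hδ, ε1, hε1, hU⟩ := uniq h hω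
  obtain ⟨ε2, hε2, hM⟩ := min_upper h hω (η := min (γ / 2) ((E - Q) / 4)) (lt_min (by linarith) (by linarith))
  obtain ⟨ε3, hε3, hLoc⟩ := localize h hω (δ := δ) (η := min γ ((E - Q) / 2)) hδ (lt_min hγ (by linarith))
  refine ⟨min ε1 (min ε2 ε3), lt_min hε1 (lt_min hε2 hε3), ?_⟩
  intro ε hε hlt μ hμ hnm
  have l1 := hlt.trans_le (min_le_left _ _)
  have l2' := hlt.trans_le ((min_le_right _ _).trans (min_le_left _ _))
  have l3 := hlt.trans_le ((min_le_right _ _).trans (min_le_right _ _))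
  have hpμ := hμ.1
  obtain ⟨ν, hν, hνm⟩ := exists_min (lam := lam) (ω := ω) h hε
  have hpν := hν.1
  have hm := hM ε hε l2'
  rw [← hνm, EA_gibbs hε hν, EReal.coe_le_coe_iff] at hm
  have q1 := gibbs_log_le hε hμ
  have q2 := gibbs_log_le hε hν
  have j1 : - IA lam μ / 2 ≤ Jf lam ω ε μ := by unfold Jf; linarith
  have j2 : - IA lam ν / 2 ≤ Jf lam ω ε ν := by unfold Jf; linarith
  have m1 := min_le_left (γ / 2) ((E - Q) / 4)
  have m2 := min_le_right (γ / 2) ((E - Q) / 4)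
  have m3 := min_le_left γ ((E - Q) / 2)
  have m4 := min_le_right γ ((E - Q) / 2)
  rw [← hνm, EA_gibbs hε hν, EA_gibbs hε hμ, ← EReal.coe_sub, EReal.coe_le_coe_iff]
  by_cases hI : IA lam μ ≤ Q + γ
  · linarith
  · exfalso
    push Not at hI
    have k1 := hLoc ε hε l3 μ hμ (by linarith)
    have k2 := hLoc ε hε l3 ν hν (by linarith)
    have flip : ∀ η : Measure (Sph d), IsGibbs lam ω ε η → (∫ x, aa o x ∂η ≤ δ ∨ ∫ x : Sph d, (1 + x.1 o) ∂η ≤ δ) →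
        ∃ η', IsGibbs lam ω ε η' ∧ ∫ x, aa o x ∂η' ≤ δ ∧ Jf lam ω ε η' = Jf lam ω ε η := by
      intro η hη hc
      have := hη.1
      rcases hc with hc | hc
      · exact ⟨η, hη, hc, rfl⟩
      · exact ⟨η.map (sneg d), gibbs_sneg hω hη, by rw [aa_sneg]; exact hc, Jf_sneg hω η⟩
    obtain ⟨μ', g1, a1, e1⟩ := flip μ hμ k1
    obtain ⟨ν', g2, a2, e2⟩ := flip ν hν k2
    have heq := hU ε hε l1 μ' ν' g1 g2 a1 a2
    apply hnm
    refine ⟨hpμ, fun η hη => ?_⟩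
    have : EA lam ω ε μ = mEps lam ω ε := by
      rw [← hνm, EA_gibbs hε hν, EA_gibbs hε hμ, ← e1, ← e2, heq]
    rw [this]
    exact mEps_le η
end final


/-- small-temperature gap for non-minimizing Gibbs critical points. -/
theorem stmt2 (d : ℕ) (hd : 2 ≤ d) (lam : Fin d → ℝ)
    (hanti : Antitone lam)
    (hgap : lam ⟨1, by omega⟩ < lam ⟨0, by omega⟩)
    (hpos : ∀ i, 0 < lam i)
    (ω : Measure (Sph d)) (hω : IsUniform ω)
    (γ : ℝ) (hγ : 0 < γ) :
    ∃ εγ : ℝ, 0 < εγ ∧ ∀ ε : ℝ, 0 < ε → ε < εγ →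
      ∀ μ : Measure (Sph d), IsGibbs lam ω ε μ → ¬ IsMinimizer lam ω ε μ →
        ((((Real.exp (lam ⟨0, by omega⟩) - (max (Real.exp (lam ⟨1, by omega⟩)) (Real.cosh (lam ⟨0, by omega⟩)))) / 2 - γ : ℝ)) : EReal) ≤ EA lam ω ε μ - mEps lam ω ε := by
  have h : Good lam ⟨0, by omega⟩ (lam ⟨1, by omega⟩) := by
    refine ⟨hpos, fun i => hanti (Fin.mk_le_of_le_val (Nat.zero_le _)), fun i hi => hanti ?_, hgap⟩
    rw [Fin.le_def]
    have : i.1 ≠ 0 := fun hh => hi (Fin.ext hh)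
    simp only
    omega
  exact main_gap h hω hγ

end
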